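/- arXiv:1505.07787 — 3 statements merged into one kernel-verified Lean document; each statement's English description precedes it below -/
import Mathlib

section
/- For any ε > 0 there exist constants c, ρ > 0 such that the probability that the kernel of a random 2n×2n boundary operator δ = U·δ_std·U⁻¹ (with U = U₊⊕U₋, U± uniform in GL(n,Z_D), and homological dimension H ≤ ρn) contains a nonzero vector of Hamming weight less than cn is O(D^{(−1/2+ε)n}). -/
/-- Index type of size `n = H + 2L`, split into blocks of sizes `H`, `L`, `L`. -/
abbrev BlockIx (H L : ℕ) : Type := Fin H ⊕ (Fin L ⊕ Fin L)

/-- The standard matrix `δ₀` whose only nonzero block is an identity `I_L`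
mapping the third block of coordinates to the second. -/
def stdDelta0 (D H L : ℕ) : Matrix (BlockIx H L) (BlockIx H L) (ZMod D) :=
  Matrix.fromBlocks 0 0 0
    (Matrix.fromBlocks (0 : Matrix (Fin L) (Fin L) (ZMod D)) 1 0 0)

/-- The random boundary operator `δ = U δ_std U⁻¹` on `Z_D^{2n} = C₊ ⊕ C₋`, where
`U = U₊ ⊕ U₋` is block diagonal and `δ_std` is off-diagonal with both blocks `δ₀`. -/
def randBoundary (D H L : ℕ) [Fact D.Prime]
    (Up Um : GL (BlockIx H L) (ZMod D)) :
    Matrix (BlockIx H L ⊕ BlockIx H L) (BlockIx H L ⊕ BlockIx H L) (ZMod D) :=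
  Matrix.fromBlocks 0 ((Up : Matrix _ _ (ZMod D)) * stdDelta0 D H L * ((Um⁻¹ : GL _ _) : Matrix _ _ (ZMod D)))
    ((Um : Matrix _ _ (ZMod D)) * stdDelta0 D H L * ((Up⁻¹ : GL _ _) : Matrix _ _ (ZMod D))) 0

/-- Hamming weight: the number of nonzero coordinates. -/
def hamWt {D : ℕ} {α : Type*} [Fintype α] (v : α → ZMod D) : ℕ :=
  (Finset.univ.filter fun i => v i ≠ 0).card

open Finset in
theorem aux_trans {p : ℕ} [Fact p.Prime] {ι : Type*} [Fintype ι] [DecidableEq ι]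
    {k k' : ι → ZMod p} (hk : k ≠ 0) (hk' : k' ≠ 0) :
    ∃ g : GL ι (ZMod p), (g : Matrix ι ι (ZMod p)).mulVec k = k' := by
  obtain ⟨g, hg⟩ := Submodule.exists_linearEquiv_restrict_eq
    ((LinearEquiv.toSpanNonzeroSingleton (ZMod p) _ k hk).symm ≪≫ₗ
      LinearEquiv.toSpanNonzeroSingleton (ZMod p) _ k' hk')
  have h1 := hg (LinearEquiv.toSpanNonzeroSingleton (ZMod p) _ k hk 1)
  simp only [LinearEquiv.trans_apply, LinearEquiv.symm_apply_apply] at h1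
  simp at h1
  refine ⟨Matrix.GeneralLinearGroup.toLin.symm
    (LinearMap.GeneralLinearGroup.ofLinearEquiv g), ?_⟩
  have h2 := Matrix.GeneralLinearGroup.toLin_apply (Matrix.GeneralLinearGroup.toLin.symm
    (LinearMap.GeneralLinearGroup.ofLinearEquiv g)) k
  rw [Matrix.mulVecLin_apply] at h2
  rw [← h2, MulEquiv.apply_symm_apply]
  exact h1.symm

open Finset in
theorem aux_fixed {p : ℕ} [Fact p.Prime] {ι : Type*} [Fintype ι] [DecidableEq ι]
    {w : ι → ZMod p} (hw : w ≠ 0) (S : Finset (ι → ZMod p)) :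
    (univ.filter fun U : GL ι (ZMod p) =>
      ((U⁻¹ : GL ι (ZMod p)) : Matrix ι ι (ZMod p)).mulVec w ∈ S).card * p ^ Fintype.card ι
      ≤ 2 * S.card * Fintype.card (GL ι (ZMod p)) := by
  classical
  have hp : 2 ≤ p := (Fact.out : p.Prime).two_le
  set f : GL ι (ZMod p) → (ι → ZMod p) := fun U =>
    ((U⁻¹ : GL ι (ZMod p)) : Matrix ι ι (ZMod p)).mulVec w with hf
  set N : ℕ := (univ.filter fun U => f U = w).card with hN
  have hf0 : ∀ U, f U ≠ 0 := by
    intro U h0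
    apply hw
    have : (U : Matrix ι ι (ZMod p)).mulVec (f U) = w := by
      simp only [hf, Matrix.mulVec_mulVec]
      rw [← Matrix.GeneralLinearGroup.coe_mul, mul_inv_cancel]
      simp
    rw [← this, h0, Matrix.mulVec_zero]
  have hfib : ∀ k, k ≠ 0 → (univ.filter fun U => f U = k).card = N := by
    intro k hk
    obtain ⟨g, hg⟩ := aux_trans hk hw
    have hinj : Function.Injective (fun x : ι → ZMod p => (g : Matrix ι ι (ZMod p)).mulVec x) :=
      Matrix.mulVec_injective_of_isUnit g.isUnit
    apply Finset.card_bij (fun U _ => U * g⁻¹)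
    · intro U hU
      simp only [mem_filter, mem_univ, true_and] at hU ⊢
      simp only [hf, mul_inv_rev, inv_inv, Matrix.GeneralLinearGroup.coe_mul] at hU ⊢
      rw [← Matrix.mulVec_mulVec, hU, hg]
    · intro a _ b _ h
      exact mul_right_cancel h
    · intro U hU
      refine ⟨U * g, ?_, by simp⟩
      simp only [mem_filter, mem_univ, true_and] at hU ⊢
      apply hinj
      simp only [hg]
      rw [← hU]
      simp only [hf, Matrix.mulVec_mulVec]
      rw [← Matrix.GeneralLinearGroup.coe_mul]
      simp
  have h1 : (univ.filter fun U => f U ∈ S).card ≤ N * S.card := by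
    apply Finset.card_le_mul_card_image_of_maps_to (f := f)
    · intro U hU
      simpa using hU
    · intro k _
      by_cases hk : k = 0
      · have : ({a ∈ univ.filter (fun U => f U ∈ S) | f a = k}) = ∅ := by
          apply Finset.filter_false_of_mem
          intro U _
          rw [hk]
          exact hf0 U
        rw [this]; simp
      · rw [← hfib k hk]
        apply Finset.card_le_card
        intro U
        simp
  have h2 : Fintype.card (GL ι (ZMod p)) = (p ^ Fintype.card ι - 1) * N := by
    have := Finset.card_eq_sum_card_fiberwise (f := f) (s := univ) (t := univ.erase 0)
      (by intro U _; simpa using hf0 U)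
    rw [← Finset.card_univ, this, Finset.sum_congr rfl (fun k hk => hfib k (by simpa using hk))]
    simp [Finset.card_erase_of_mem, ZMod.card]
  have h3 : 2 ≤ p ^ Fintype.card ι := by
    have : Nonempty ι := by
      by_contra h
      rw [not_nonempty_iff] at h
      exact hw (Subsingleton.elim _ _)
    calc 2 ≤ p := hp
      _ = p ^ 1 := (pow_one p).symm
      _ ≤ _ := Nat.pow_le_pow_right (by lia) Fintype.card_pos
  calc _ ≤ N * S.card * p ^ Fintype.card ι := Nat.mul_le_mul_right _ h1
    _ ≤ N * S.card * (2 * (p ^ Fintype.card ι - 1)) := Nat.mul_le_mul_left _ (by lia)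
    _ = _ := by rw [h2]; ring

open Finset in
theorem aux_weight (p : ℕ) [Fact p.Prime] (η : ℝ) (hη : 0 < η) :
    ∃ c : ℝ, 0 < c ∧ ∀ (ι : Type) [Fintype ι] [DecidableEq ι],
      ((univ.filter fun v : ι → ZMod p => (hamWt v : ℝ) < c * Fintype.card ι).card : ℝ)
        ≤ (p : ℝ) ^ (η * Fintype.card ι) := by
  classical
  have hp : (1 : ℝ) < p := by exact_mod_cast (Fact.out : p.Prime).one_lt
  have hp0 : (0 : ℝ) < p := by linarith
  have hlp : 0 < Real.log p := Real.log_pos hp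
  set y : ℝ := (p : ℝ) ^ (η / 2) with hy
  have hy1 : 1 < y := Real.one_lt_rpow hp (by linarith)
  set x : ℝ := min (1 / 2) ((y - 1) / (p - 1)) with hx
  have hx0 : 0 < x := lt_min (by norm_num) (div_pos (by linarith) (by linarith))
  have hx1 : x < 1 := lt_of_le_of_lt (min_le_left _ _) (by norm_num)
  have hxy : 1 + (p - 1) * x ≤ y := by
    have : x ≤ (y - 1) / (p - 1) := min_le_right _ _
    rw [le_div_iff₀ (by linarith)] at this
    linarith
  have hlx : Real.log x < 0 := Real.log_neg hx0 hx1
  refine ⟨(η / 2) * Real.log p / (- Real.log x), by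
    apply div_pos <;> first | positivity | linarith, ?_⟩
  intro ι _ _
  set c := (η / 2) * Real.log p / (- Real.log x) with hc
  have hxc : x ^ (-c) = y := by
    rw [hy, Real.rpow_def_of_pos hx0, Real.rpow_def_of_pos hp0]
    congr 1
    rw [hc]
    have hlx' := hlx.ne
    field_simp
  set n := Fintype.card ι
  have hsum : ∑ v : ι → ZMod p, x ^ hamWt v = (1 + (p - 1) * x) ^ n := by
    have h1 : ∀ v : ι → ZMod p, x ^ hamWt v = ∏ i, if v i ≠ 0 then x else 1 := by
      intro v
      rw [hamWt, Finset.prod_ite]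
      simp
    simp_rw [h1]
    rw [← Fintype.prod_sum (fun (_ : ι) (a : ZMod p) => if a ≠ 0 then x else 1)]
    rw [Finset.prod_const, Finset.card_univ]
    congr 1
    rw [← Finset.add_sum_erase univ _ (mem_univ (0 : ZMod p))]
    rw [Finset.sum_congr rfl (g := fun _ => x) (by
      intro a ha
      rw [if_pos (by simpa using ha)])]
    rw [Finset.sum_const, Finset.card_erase_of_mem (mem_univ _), Finset.card_univ, ZMod.card,
      nsmul_eq_mul, Nat.cast_sub (Fact.out : p.Prime).one_lt.le]
    simp
  have hyn : y ^ n * y ^ n = (p : ℝ) ^ (η * n) := by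
    rw [← mul_pow, hy, ← Real.rpow_add hp0, ← Real.rpow_natCast, ← Real.rpow_mul hp0.le]
    congr 1; ring
  calc ((univ.filter fun v : ι → ZMod p => (hamWt v : ℝ) < c * n).card : ℝ)
      = ∑ v ∈ univ.filter fun v : ι → ZMod p => (hamWt v : ℝ) < c * n, (1 : ℝ) := by simp
    _ ≤ ∑ v ∈ univ.filter fun v : ι → ZMod p => (hamWt v : ℝ) < c * n, x ^ hamWt v * y ^ n := by
        apply Finset.sum_le_sum
        intro v hv
        simp only [mem_filter, mem_univ, true_and] at hv
        rw [← hxc, ← Real.rpow_natCast, ← Real.rpow_natCast, ← Real.rpow_mul hx0.le,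
          ← Real.rpow_add hx0]
        apply Real.one_le_rpow_of_pos_of_le_one_of_nonpos hx0 hx1.le
        linarith
    _ ≤ ∑ v : ι → ZMod p, x ^ hamWt v * y ^ n := by
        apply Finset.sum_le_sum_of_subset_of_nonneg (Finset.subset_univ _)
        intros; positivity
    _ = (1 + (p - 1) * x) ^ n * y ^ n := by rw [← Finset.sum_mul, hsum]
    _ ≤ y ^ n * y ^ n := by
        gcongr
    _ = _ := hyn

theorem aux_ker {D H L : ℕ} (k : BlockIx H L → ZMod D)
    (h : (stdDelta0 D H L).mulVec k = 0) (j : Fin L) : k (Sum.inr (Sum.inr j)) = 0 := by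
  have := congrFun h (Sum.inr (Sum.inl j))
  simpa [stdDelta0, Matrix.mulVec, dotProduct, Fintype.sum_sum_type, Matrix.one_apply] using this

open Finset in
theorem aux_kercard (D H L : ℕ) [Fact D.Prime] :
    (univ.filter fun k : BlockIx H L → ZMod D => (stdDelta0 D H L).mulVec k = 0).card
      ≤ D ^ (H + L) := by
  have : D ^ (H + L) = (univ : Finset (Fin H ⊕ Fin L → ZMod D)).card := by
    simp [ZMod.card]
  rw [this]
  apply Finset.card_le_card_of_injOn
    (fun k => Sum.elim (fun i => k (Sum.inl i)) (fun j => k (Sum.inr (Sum.inl j))))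
  · intro k _; simp
  · intro a ha b hb hab
    simp only [coe_filter, mem_univ, true_and, Set.mem_setOf_eq] at ha hb
    funext i
    rcases i with i | i | i
    · exact congrFun hab (Sum.inl i)
    · exact congrFun hab (Sum.inr i)
    · rw [aux_ker a ha, aux_ker b hb]

theorem aux_half {D : ℕ} [Fact D.Prime] {ι : Type*} [Fintype ι] [DecidableEq ι]
    (A B : GL ι (ZMod D)) (M : Matrix ι ι (ZMod D)) (w : ι → ZMod D)
    (h : ((A : Matrix ι ι (ZMod D)) * M * ((B⁻¹ : GL ι (ZMod D)) : Matrix ι ι (ZMod D))).mulVec w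
      = 0) :
    M.mulVec (((B⁻¹ : GL ι (ZMod D)) : Matrix ι ι (ZMod D)).mulVec w) = 0 := by
  have hinj := Matrix.mulVec_injective_of_isUnit A.isUnit
  apply hinj
  simpa [Matrix.mulVec_mulVec, mul_assoc] using h

theorem aux_wt {D : ℕ} {α β : Type*} [Fintype α] [Fintype β] (v : α ⊕ β → ZMod D) :
    hamWt v = hamWt (v ∘ Sum.inl) + hamWt (v ∘ Sum.inr) := by
  simp [hamWt, Finset.card_filter, Fintype.sum_sum_type]

/-- For any `ε > 0` there are `c, ρ > 0` such that the probability (over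
uniform `U₊, U₋ ∈ GL(n, Z_D)`) that the kernel of the random `2n×2n` boundary operator
with homological dimension `H ≤ ρn` contains a nonzero vector of Hamming weight less
than `cn` is `O(D^{(−1/2+ε)n})`. -/
theorem random_boundary_kernel_min_weight
    {D : ℕ} [Fact D.Prime] (hDodd : Odd D) (ε : ℝ) (hε : 0 < ε) :
    ∃ c ρ K : ℝ, 0 < c ∧ 0 < ρ ∧ 0 < K ∧
      ∀ H L : ℕ, (H : ℝ) ≤ ρ * ((H : ℝ) + 2 * L) →
        (Nat.card {U : GL (BlockIx H L) (ZMod D) × GL (BlockIx H L) (ZMod D) //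
            ∃ v : (BlockIx H L ⊕ BlockIx H L) → ZMod D, v ≠ 0 ∧
              (randBoundary D H L U.1 U.2).mulVec v = 0 ∧
              (hamWt v : ℝ) < c * ((H : ℝ) + 2 * L)} : ℝ) /
          (Nat.card (GL (BlockIx H L) (ZMod D) × GL (BlockIx H L) (ZMod D)) : ℝ) ≤
        K * (D : ℝ) ^ ((-1/2 + ε) * ((H : ℝ) + 2 * L)) := by
  classical
  obtain ⟨c, hc, hW⟩ := aux_weight D (ε / 2) (by linarith)
  refine ⟨c, ε, 4, hc, hε, by norm_num, ?_⟩
  intro H L hH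
  have hD1 : (1 : ℝ) < D := by exact_mod_cast (Fact.out : D.Prime).one_lt
  have hD0 : (0 : ℝ) < D := by linarith
  have hcard : Fintype.card (BlockIx H L) = H + (L + L) := by simp
  set W := Finset.univ.filter fun w : BlockIx H L → ZMod D =>
    (hamWt w : ℝ) < c * Fintype.card (BlockIx H L) with hWdef
  set S := Finset.univ.filter fun k : BlockIx H L → ZMod D =>
    (stdDelta0 D H L).mulVec k = 0 with hS
  let A : (BlockIx H L → ZMod D) → Finset (GL (BlockIx H L) (ZMod D)) := fun w =>
    Finset.univ.filter fun U => ((U⁻¹ : GL (BlockIx H L) (ZMod D)) :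
      Matrix (BlockIx H L) (BlockIx H L) (ZMod D)).mulVec w ∈ S
  set G := Fintype.card (GL (BlockIx H L) (ZMod D)) with hG
  have hGpos : 0 < G := Fintype.card_pos
  set W0 := W.erase 0
  let T := W0.biUnion A
  have hT : T.card * D ^ (H + (L + L)) ≤ W.card * (2 * D ^ (H + L) * G) := by
    calc T.card * D ^ (H + (L + L))
        ≤ (∑ w ∈ W0, (A w).card) * D ^ (H + (L + L)) :=
          Nat.mul_le_mul_right _ Finset.card_biUnion_le
      _ = ∑ w ∈ W0, (A w).card * D ^ (H + (L + L)) := Finset.sum_mul _ _ _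
      _ ≤ ∑ w ∈ W0, (2 * D ^ (H + L) * G) := by
          apply Finset.sum_le_sum
          intro w hw
          have h := aux_fixed (Finset.ne_of_mem_erase hw) S
          rw [hcard] at h
          refine h.trans ?_
          gcongr
          exact aux_kercard D H L
      _ = W0.card * (2 * D ^ (H + L) * G) := by simp
      _ ≤ _ := Nat.mul_le_mul_right _ (Finset.card_le_card (Finset.erase_subset _ _))
  have hbad : Nat.card {U : GL (BlockIx H L) (ZMod D) × GL (BlockIx H L) (ZMod D) //
            ∃ v : (BlockIx H L ⊕ BlockIx H L) → ZMod D, v ≠ 0 ∧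
              (randBoundary D H L U.1 U.2).mulVec v = 0 ∧
              (hamWt v : ℝ) < c * ((H : ℝ) + 2 * L)} ≤ 2 * (T.card * G) := by
    rw [Nat.card_eq_fintype_card, Fintype.card_subtype]
    calc _ ≤ ((T ×ˢ Finset.univ) ∪ (Finset.univ ×ˢ T)).card := by
          apply Finset.card_le_card
          rintro ⟨Up, Um⟩ hU
          simp only [Finset.mem_filter, Finset.mem_univ, true_and] at hU
          obtain ⟨v, hv0, hker, hwt⟩ := hU
          have hv : v = Sum.elim (v ∘ Sum.inl) (v ∘ Sum.inr) := (Sum.elim_comp_inl_inr v).symm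
          rw [hv, randBoundary, Matrix.fromBlocks_mulVec] at hker
          have hk1 := congrArg (fun u => u ∘ Sum.inl) hker
          have hk2 := congrArg (fun u => u ∘ Sum.inr) hker
          simp only [Sum.elim_comp_inl, Sum.elim_comp_inr, Matrix.zero_mulVec, zero_add,
            add_zero] at hk1 hk2
          have e1 := aux_half _ _ _ _ hk1
          have e2 := aux_half _ _ _ _ hk2
          have hwt' := aux_wt v
          have hcast : (Fintype.card (BlockIx H L) : ℝ) = H + 2 * L := by
            rw [hcard]; push_cast; ring
          rw [hwt'] at hwt
          push_cast at hwt
          have n1 : (0 : ℝ) ≤ hamWt (v ∘ Sum.inl) := Nat.cast_nonneg _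
          have n2 : (0 : ℝ) ≤ hamWt (v ∘ Sum.inr) := Nat.cast_nonneg _
          have hor : v ∘ Sum.inl ≠ 0 ∨ v ∘ Sum.inr ≠ 0 := by
            by_contra hcon
            push Not at hcon
            apply hv0
            rw [hv, hcon.1, hcon.2]
            funext i
            rcases i with i | i <;> rfl
          simp only [Finset.mem_union, Finset.mem_product, Finset.mem_univ, and_true, true_and]
          rcases hor with h | h
          · left
            apply Finset.mem_biUnion.mpr
            refine ⟨v ∘ Sum.inl, Finset.mem_erase.mpr ⟨h, ?_⟩, ?_⟩
            · simp only [hWdef, Finset.mem_filter, Finset.mem_univ, true_and]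
              rw [hcast]; linarith
            · simp only [A, hS, Finset.mem_filter, Finset.mem_univ, true_and]
              exact e2
          · right
            apply Finset.mem_biUnion.mpr
            refine ⟨v ∘ Sum.inr, Finset.mem_erase.mpr ⟨h, ?_⟩, ?_⟩
            · simp only [hWdef, Finset.mem_filter, Finset.mem_univ, true_and]
              rw [hcast]; linarith
            · simp only [A, hS, Finset.mem_filter, Finset.mem_univ, true_and]
              exact e1
      _ ≤ (T ×ˢ Finset.univ).card + (Finset.univ ×ˢ T).card := Finset.card_union_le _ _
      _ = _ := by
          rw [Finset.card_product, Finset.card_product, Finset.card_univ, ← hG]; ring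
  have htot : Nat.card (GL (BlockIx H L) (ZMod D) × GL (BlockIx H L) (ZMod D)) = G * G := by
    rw [Nat.card_eq_fintype_card, Fintype.card_prod]
  rw [htot]
  have hGr : (0 : ℝ) < G := by exact_mod_cast hGpos
  have hbadr : ((Nat.card {U : GL (BlockIx H L) (ZMod D) × GL (BlockIx H L) (ZMod D) //
            ∃ v : (BlockIx H L ⊕ BlockIx H L) → ZMod D, v ≠ 0 ∧
              (randBoundary D H L U.1 U.2).mulVec v = 0 ∧
              (hamWt v : ℝ) < c * ((H : ℝ) + 2 * L)} : ℕ) : ℝ) ≤ 2 * (T.card * G) := by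
    exact_mod_cast hbad
  have hTr : (T.card : ℝ) * (D : ℝ) ^ (H + (L + L)) ≤ W.card * (2 * (D : ℝ) ^ (H + L) * G) := by
    exact_mod_cast hT
  have hTr2 : (T.card : ℝ) * (D : ℝ) ^ L ≤ W.card * (2 * G) := by
    have hpos : (0 : ℝ) < (D : ℝ) ^ (H + L) := by positivity
    refine le_of_mul_le_mul_right ?_ hpos
    calc (T.card : ℝ) * (D : ℝ) ^ L * (D : ℝ) ^ (H + L)
        = (T.card : ℝ) * (D : ℝ) ^ (H + (L + L)) := by ring
      _ ≤ _ := hTr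
      _ = _ := by ring
  have hWr : (W.card : ℝ) ≤ (D : ℝ) ^ (ε / 2 * ((H : ℝ) + 2 * L)) := by
    have := hW (BlockIx H L)
    have hcast : (Fintype.card (BlockIx H L) : ℝ) = H + 2 * L := by
      rw [hcard]; push_cast; ring
    rw [← hcast]
    exact this
  have hexp : (D : ℝ) ^ (ε / 2 * ((H : ℝ) + 2 * L)) ≤
      (D : ℝ) ^ ((-1/2 + ε) * ((H : ℝ) + 2 * L)) * (D : ℝ) ^ L := by
    rw [← Real.rpow_natCast (D : ℝ) L, ← Real.rpow_add hD0]
    apply Real.rpow_le_rpow_of_exponent_le hD1.le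
    linarith
  have hDL : (0 : ℝ) < (D : ℝ) ^ L := by positivity
  set E := (D : ℝ) ^ ((-1/2 + ε) * ((H : ℝ) + 2 * L))
  have hTE : (T.card : ℝ) ≤ 2 * E * G := by
    refine le_of_mul_le_mul_right ?_ hDL
    calc _ ≤ _ := hTr2
      _ ≤ (E * (D : ℝ) ^ L) * (2 * G) := by gcongr; exact hWr.trans hexp
      _ = _ := by ring
  push_cast
  rw [div_le_iff₀ (by positivity)]
  calc _ ≤ _ := hbadr
    _ ≤ 2 * (2 * E * G * G) := by gcongr
    _ = _ := by ring
end

section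
/- Let E^{A,B,R}_{a,b,r} denote the number of rank-R matrices of size A×B over Z_D that extend a fixed rank-r matrix of size a×b (placed in the upper-left corner). Then E^{A,B,R}_{a,b,r} = O(1)·D^{(A+B−b)R − br − R² + (b−a+r+R)²/4}. -/
/-- constant: reciprocal of `∏_{i=1}^d (1 - q^{-i})` -/
noncomputable def extC (q : ℝ) : ℕ → ℝ
  | 0 => 1
  | d + 1 => extC q d / (1 - (q ^ (d + 1))⁻¹)

lemma inv_pow_le_half {q : ℝ} (hq : 2 ≤ q) (d : ℕ) : (q ^ (d + 1))⁻¹ ≤ (1 / 2 : ℝ) ^ (d + 1) := by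
  rw [one_div, inv_pow]
  gcongr

lemma one_sub_pos_aux {q : ℝ} (hq : 2 ≤ q) (d : ℕ) : 0 < 1 - (q ^ (d + 1))⁻¹ := by
  have h1 := inv_pow_le_half hq d
  have h2 : (1 / 2 : ℝ) ^ (d + 1) ≤ 1 / 2 := by
    rw [pow_succ]
    have : (1 / 2 : ℝ) ^ d ≤ 1 := pow_le_one₀ (by norm_num) (by norm_num)
    linarith
  linarith

lemma extC_pos {q : ℝ} (hq : 2 ≤ q) (d : ℕ) : 0 < extC q d := by
  induction d with
  | zero => simp [extC]
  | succ d ih => exact div_pos ih (one_sub_pos_aux hq d)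

lemma extC_inv {q : ℝ} (hq : 2 ≤ q) (d : ℕ) :
    extC q (d + 1) * (1 / 4 + (1 / 2 : ℝ) ^ (d + 2)) ≤ 1 := by
  induction d with
  | zero =>
    have h := one_sub_pos_aux hq 0
    have h1 := inv_pow_le_half hq 0
    simp only [extC]
    rw [div_mul_eq_mul_div, div_le_one h]
    norm_num at *
    linarith
  | succ d ih =>
    have h := one_sub_pos_aux hq (d + 1)
    have h1 := inv_pow_le_half hq (d + 1)
    have hp := extC_pos hq (d + 1)
    rw [show extC q (d + 1 + 1) = extC q (d + 1) / (1 - (q ^ (d + 1 + 1))⁻¹) from rfl,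
      div_mul_eq_mul_div, div_le_one h]
    set y : ℝ := (1 / 2 : ℝ) ^ (d + 2) with hy
    have hy4 : y ≤ 1 / 4 := by
      rw [hy, pow_add]
      have : (1 / 2 : ℝ) ^ d ≤ 1 := pow_le_one₀ (by norm_num) (by norm_num)
      linarith
    have hy0 : 0 < y := by positivity
    have e : (1 / 2 : ℝ) ^ (d + 1 + 2) = y / 2 := by rw [hy]; ring
    rw [e]
    have : extC q (d + 1) * (1 / 4 + y / 2) ≤ extC q (d + 1) * (1 / 4 + y) * (1 - y) := by
      rw [mul_assoc]
      apply mul_le_mul_of_nonneg_left _ hp.le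
      nlinarith
    have h3 : extC q (d + 1) * (1 / 4 + y) * (1 - y) ≤ 1 * (1 - y) :=
      mul_le_mul_of_nonneg_right ih (by linarith)
    linarith

lemma extC_le {q : ℝ} (hq : 2 ≤ q) (d : ℕ) : extC q d ≤ 4 := by
  cases d with
  | zero => simp [extC]
  | succ d =>
    have h := extC_inv hq d
    have hp := extC_pos hq (d + 1)
    have : 0 < (1 / 2 : ℝ) ^ (d + 2) := by positivity
    nlinarith [mul_pos hp this]

open Module Submodule in
lemma ext_count {F V : Type*} [Field F] [Fintype F] [AddCommGroup V] [Module F V] [Fintype V]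
    (q : ℝ) (hqF : q = Fintype.card F) (hq : 2 ≤ q) (j : ℕ) :
    ∀ (d : ℕ) (W : Submodule F V),
      (Nat.card {f : Fin j → V // finrank F ↥(W ⊔ span F (Set.range f)) = finrank F W + d} : ℝ) ≤
        extC q d * q ^ ((finrank F W : ℤ) * j +
          d * ((finrank F V : ℤ) + j - finrank F W - d)) := by
  classical
  have hq0 : q ≠ 0 := by linarith
  have hqp : 0 < q := by linarith
  induction j with
  | zero =>
    intro d W
    cases d with
    | zero =>
      have h1 : Nat.card {f : Fin 0 → V //
          finrank F ↥(W ⊔ span F (Set.range f)) = finrank F W + 0} ≤ 1 :=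
        Finite.card_le_one_iff_subsingleton.2 inferInstance
      have h2 : (Nat.card {f : Fin 0 → V //
          finrank F ↥(W ⊔ span F (Set.range f)) = finrank F W + 0} : ℝ) ≤ 1 := by
        exact_mod_cast h1
      refine h2.trans (le_of_eq ?_)
      simp [extC]
    | succ d =>
      have : IsEmpty {f : Fin 0 → V //
          finrank F ↥(W ⊔ span F (Set.range f)) = finrank F W + (d + 1)} := by
        constructor
        rintro ⟨f, hf⟩
        rw [Set.range_eq_empty, span_empty, sup_bot_eq] at hf
        omega
      rw [Nat.card_of_isEmpty]
      have := extC_pos hq (d + 1)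
      simp only [Nat.cast_zero]
      positivity
  | succ j ih =>
    intro d W
    let e : {f : Fin (j + 1) → V //
        finrank F ↥(W ⊔ span F (Set.range f)) = finrank F W + d} ≃
        (Σ v : V, {f : Fin j → V //
          finrank F ↥((W ⊔ span F {v}) ⊔ span F (Set.range f)) = finrank F W + d}) :=
      { toFun := fun f => ⟨f.1 0, Fin.tail f.1, by
          have h := f.2
          rw [← Fin.cons_self_tail f.1, Fin.range_cons, span_insert, ← sup_assoc] at h
          exact h⟩
        invFun := fun p => ⟨Fin.cons p.1 p.2.1, by
          have h := p.2.2
          rw [Fin.range_cons, span_insert, ← sup_assoc]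
          exact h⟩
        left_inv := fun f => by simp
        right_inv := fun p => rfl }
    rw [Nat.card_congr e, Nat.card_sigma]
    push_cast
    rw [← Finset.sum_filter_add_sum_filter_not Finset.univ (fun v => v ∈ W)]
    have hcW : ((Finset.univ.filter (fun v => v ∈ W)).card : ℝ) = q ^ (finrank F W : ℤ) := by
      have : Fintype.card W = Fintype.card F ^ finrank F W := Module.card_eq_pow_finrank
      rw [zpow_natCast, hqF, ← Nat.cast_pow, ← this, Fintype.card_subtype]
    have hcV : ((Finset.univ.filter (fun v => ¬ v ∈ W)).card : ℝ) ≤ q ^ (finrank F V : ℤ) := by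
      have : Fintype.card V = Fintype.card F ^ finrank F V := Module.card_eq_pow_finrank
      rw [zpow_natCast, hqF, ← Nat.cast_pow, ← this]
      exact_mod_cast Finset.card_le_univ _
    have h1 : ∑ v ∈ Finset.univ.filter (fun v => v ∈ W), (Nat.card {f : Fin j → V //
          finrank F ↥((W ⊔ span F {v}) ⊔ span F (Set.range f)) = finrank F W + d} : ℝ) ≤
        q ^ (finrank F W : ℤ) * (extC q d * q ^ ((finrank F W : ℤ) * j +
          d * ((finrank F V : ℤ) + j - finrank F W - d))) := by
      rw [← hcW, ← nsmul_eq_mul]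
      apply Finset.sum_le_card_nsmul
      intro v hv
      have hv' : v ∈ W := by simpa using hv
      have : W ⊔ span F {v} = W := by simpa using hv'
      rw [this]
      exact ih d W
    have e1 : q ^ (finrank F W : ℤ) * (extC q d * q ^ ((finrank F W : ℤ) * j +
          d * ((finrank F V : ℤ) + j - finrank F W - d))) =
        extC q d * (q ^ d)⁻¹ * q ^ ((finrank F W : ℤ) * (j + 1 : ℕ) +
          d * ((finrank F V : ℤ) + (j + 1 : ℕ) - finrank F W - d)) := by
      rw [← zpow_natCast, ← zpow_neg, mul_left_comm, mul_assoc, ← zpow_add₀ hq0, ← zpow_add₀ hq0]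
      congr 2
      push_cast
      ring
    rw [e1] at h1
    cases d with
    | zero =>
      have h2 : ∑ v ∈ Finset.univ.filter (fun v => ¬ v ∈ W), (Nat.card {f : Fin j → V //
          finrank F ↥((W ⊔ span F {v}) ⊔ span F (Set.range f)) = finrank F W + 0} : ℝ) = 0 := by
        apply Finset.sum_eq_zero
        intro v hv
        have hv' : v ∉ W := by simpa using hv
        have hr := finrank_sup_span_singleton hv'
        have : IsEmpty {f : Fin j → V //
          finrank F ↥((W ⊔ span F {v}) ⊔ span F (Set.range f)) = finrank F W + 0} := by
          constructor
          rintro ⟨f, hf⟩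
          have := Submodule.finrank_mono
            (le_sup_left : W ⊔ span F {v} ≤ (W ⊔ span F {v}) ⊔ span F (Set.range f))
          omega
        rw [Nat.card_of_isEmpty]; simp
      rw [h2, add_zero]
      simpa using h1
    | succ d =>
      have h2 : ∑ v ∈ Finset.univ.filter (fun v => ¬ v ∈ W), (Nat.card {f : Fin j → V //
          finrank F ↥((W ⊔ span F {v}) ⊔ span F (Set.range f)) = finrank F W + (d + 1)} : ℝ) ≤
          q ^ (finrank F V : ℤ) * (extC q d * q ^ (((finrank F W + 1 : ℕ) : ℤ) * j +
          d * ((finrank F V : ℤ) + j - (finrank F W + 1 : ℕ) - d))) := by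
        have hC := extC_pos hq d
        refine le_trans ?_ (mul_le_mul_of_nonneg_right hcV (by positivity))
        rw [← nsmul_eq_mul]
        apply Finset.sum_le_card_nsmul
        intro v hv
        have hv' : v ∉ W := by simpa using hv
        have hr := finrank_sup_span_singleton hv'
        have := ih d (W ⊔ span F {v})
        rw [hr, add_assoc, add_comm 1 d] at this
        exact this
      have e2 : q ^ (finrank F V : ℤ) * (extC q d * q ^ (((finrank F W + 1 : ℕ) : ℤ) * j +
          d * ((finrank F V : ℤ) + j - (finrank F W + 1 : ℕ) - d))) =
          extC q d * q ^ ((finrank F W : ℤ) * (j + 1 : ℕ) +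
          (d + 1 : ℕ) * ((finrank F V : ℤ) + (j + 1 : ℕ) - finrank F W - (d + 1 : ℕ))) := by
        rw [mul_left_comm, ← zpow_add₀ hq0]
        congr 2
        push_cast
        ring
      rw [e2] at h2
      have hd : extC q d = extC q (d + 1) * (1 - (q ^ (d + 1))⁻¹) := by
        rw [extC, div_mul_cancel₀ _ (one_sub_pos_aux hq d).ne']
      refine (add_le_add h1 h2).trans (le_of_eq ?_)
      rw [hd, ← add_mul]
      congr 1
      ring

open Module Submodule in
lemma col_count {F : Type*} [Field F] [Fintype F] (q : ℝ) (hqF : q = Fintype.card F) (hq : 2 ≤ q)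
    {m n : ℕ} (j d : ℕ) (N : Matrix (Fin m) (Fin n) F) :
    (Nat.card {M : Matrix (Fin m) (Fin (n + j)) F //
        M.rank = N.rank + d ∧ M.submatrix id (Fin.castAdd j) = N} : ℝ) ≤
      4 * q ^ ((N.rank : ℤ) * j + d * ((m : ℤ) + j - N.rank - d)) := by
  classical
  have h := ext_count (F := F) (V := Fin m → F) q hqF hq j d (span F (Set.range N.col))
  rw [← Matrix.rank_eq_finrank_span_cols, Module.finrank_fin_fun] at h
  refine le_trans ?_ (h.trans (mul_le_mul_of_nonneg_right (extC_le hq d) (by positivity)))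
  norm_cast
  have key : ∀ M : Matrix (Fin m) (Fin (n + j)) F, M.submatrix id (Fin.castAdd j) = N →
      span F (Set.range N.col) ⊔ span F (Set.range (fun i : Fin j => M.col (Fin.natAdd n i))) =
        span F (Set.range M.col) := by
    rintro M rfl
    rw [← span_union]
    congr 1
    ext x
    simp only [Set.mem_union, Set.mem_range]
    constructor
    · rintro (⟨i, rfl⟩ | ⟨i, rfl⟩)
      · exact ⟨Fin.castAdd j i, rfl⟩
      · exact ⟨_, rfl⟩
    · rintro ⟨i, rfl⟩
      induction i using Fin.addCases with
      | left i => exact Or.inl ⟨i, rfl⟩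
      | right i => exact Or.inr ⟨i, rfl⟩
  refine Nat.card_le_card_of_injective
    (fun M => ⟨fun i : Fin j => M.1.col (Fin.natAdd n i), ?_⟩) ?_
  · rw [key M.1 M.2.2, ← Matrix.rank_eq_finrank_span_cols]
    exact M.2.1
  · rintro ⟨M, hM⟩ ⟨M', hM'⟩ hh
    simp only [Subtype.mk.injEq] at hh ⊢
    ext x i
    induction i using Fin.addCases with
    | left i => exact congrFun (congrFun (hM.2.trans hM'.2.symm) x) i
    | right i => exact congrFun (congrFun hh i) x

lemma row_count {F : Type*} [Field F] [Fintype F] (q : ℝ) (hqF : q = Fintype.card F) (hq : 2 ≤ q)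
    {m n : ℕ} (i d : ℕ) (N : Matrix (Fin m) (Fin n) F) :
    (Nat.card {M : Matrix (Fin (m + i)) (Fin n) F //
        M.rank = N.rank + d ∧ M.submatrix (Fin.castAdd i) id = N} : ℝ) ≤
      4 * q ^ ((N.rank : ℤ) * i + d * ((n : ℤ) + i - N.rank - d)) := by
  have h := col_count q hqF hq i d N.transpose
  rw [Matrix.rank_transpose] at h
  refine le_trans ?_ h
  norm_cast
  refine Nat.card_le_card_of_injective (fun M => ⟨M.1.transpose, ?_, ?_⟩) ?_
  · rw [Matrix.rank_transpose]; exact M.2.1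
  · rw [← Matrix.transpose_submatrix, M.2.2]
  · rintro ⟨M, hM⟩ ⟨M', hM'⟩ hh
    simpa using hh

lemma rpow_sum_bound (q : ℝ) (hq : 2 ≤ q) : ∃ T : ℝ, 0 < T ∧ ∀ (x : ℝ) (n : ℕ),
    ∑ s ∈ Finset.range n, q ^ (-((s : ℝ) - x) ^ 2) ≤ T := by
  have hq0 : 0 < q := by linarith
  have hsum : Summable (fun z : ℤ => q ^ (-|(z : ℝ)|)) := by
    have hg : Summable (fun n : ℕ => (q⁻¹) ^ n) :=
      summable_geometric_of_lt_one (by positivity) (inv_lt_one_of_one_lt₀ (by linarith))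
    have he : ∀ n : ℕ, q ^ (-|(n : ℝ)|) = (q⁻¹) ^ n := by
      intro n
      rw [abs_of_nonneg (Nat.cast_nonneg n), Real.rpow_neg hq0.le, Real.rpow_natCast, inv_pow]
    apply Summable.of_nat_of_neg
    · simpa [he] using hg
    · simpa [he] using hg
  refine ⟨q ^ (2 : ℝ) * ∑' z : ℤ, q ^ (-|(z : ℝ)|), ?_, ?_⟩
  · have := hsum.tsum_pos (fun z => by positivity) 0 (by positivity)
    positivity
  · intro x n
    have h1 : ∀ s ∈ Finset.range n, q ^ (-((s : ℝ) - x) ^ 2) ≤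
        q ^ (2 : ℝ) * q ^ (-|(((s : ℤ) - ⌊x⌋ : ℤ) : ℝ)|) := by
      intro s _
      rw [← Real.rpow_add hq0]
      apply Real.rpow_le_rpow_of_exponent_le (by linarith)
      push_cast
      have h2 := Int.floor_le x
      have h3 := Int.lt_floor_add_one x
      have h4 : |(s : ℝ) - ⌊x⌋| ≤ |(s : ℝ) - x| + 1 := by
        calc |(s : ℝ) - ⌊x⌋| = |((s : ℝ) - x) + (x - ⌊x⌋)| := by ring_nf
          _ ≤ |(s : ℝ) - x| + |x - ⌊x⌋| := abs_add_le _ _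
          _ ≤ _ := by rw [abs_of_nonneg (by linarith : 0 ≤ x - ⌊x⌋)]; linarith
      nlinarith [sq_abs ((s : ℝ) - x), sq_nonneg (|(s : ℝ) - x| - 1 / 2)]
    refine (Finset.sum_le_sum h1).trans ?_
    rw [← Finset.mul_sum]
    apply mul_le_mul_of_nonneg_left _ (by positivity)
    let g : ℕ ↪ ℤ := ⟨fun s => (s : ℤ) - ⌊x⌋, fun u v h => by simpa using h⟩
    have := hsum.sum_le_tsum ((Finset.range n).map g) (fun z _ => by positivity)
    rw [Finset.sum_map] at this
    exact this

lemma main_count {F : Type*} [Field F] [Fintype F] (q : ℝ) (hqF : q = Fintype.card F) (hq : 2 ≤ q)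
    (T : ℝ) (hT : ∀ (x : ℝ) (n : ℕ), ∑ s ∈ Finset.range n, q ^ (-((s : ℝ) - x) ^ 2) ≤ T)
    (a b i j R : ℕ) (N : Matrix (Fin a) (Fin b) F) :
    (Nat.card {M : Matrix (Fin (a + i)) (Fin (b + j)) F //
        M.rank = R ∧ M.submatrix (Fin.castAdd i) (Fin.castAdd j) = N} : ℝ) ≤
      16 * T * q ^ ((((a + i : ℕ) : ℝ) + ((b + j : ℕ) : ℝ) - b) * R - (b : ℝ) * (N.rank : ℝ) -
        (R : ℝ) ^ 2 + ((b : ℝ) - a + (N.rank : ℝ) + R) ^ 2 / 4) := by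
  classical
  have hq0 : 0 < q := by linarith
  set E : ℝ := (((a + i : ℕ) : ℝ) + ((b + j : ℕ) : ℝ) - b) * R - (b : ℝ) * (N.rank : ℝ) -
        (R : ℝ) ^ 2 + ((b : ℝ) - a + (N.rank : ℝ) + R) ^ 2 / 4 with hE
  set x : ℝ := ((b : ℝ) - a + (N.rank : ℝ) + R) / 2 with hx
  let Y := {M : Matrix (Fin (a + i)) (Fin b) F //
    M.rank ≤ R ∧ M.submatrix (Fin.castAdd i) id = N}
  let Z : Y → Type _ := fun M' => {M : Matrix (Fin (a + i)) (Fin (b + j)) F //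
    M.rank = R ∧ M.submatrix id (Fin.castAdd j) = M'.1}
  have step1 : Nat.card {M : Matrix (Fin (a + i)) (Fin (b + j)) F //
        M.rank = R ∧ M.submatrix (Fin.castAdd i) (Fin.castAdd j) = N} ≤
      Nat.card (Σ y : Y, Z y) := by
    refine Nat.card_le_card_of_injective
      (fun M => ⟨⟨M.1.submatrix id (Fin.castAdd j), ?_, ?_⟩, ⟨M.1, M.2.1, rfl⟩⟩) ?_
    · exact (Matrix.rank_submatrix_le _ _ _).trans M.2.1.le
    · exact M.2.2
    · intro M M' h
      have h2 := congrArg (fun p : (Σ y : Y, Z y) => p.2.1) h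
      exact Subtype.ext h2
  have step2 : (Nat.card (Σ y : Y, Z y) : ℝ) = ∑ y : Y, (Nat.card (Z y) : ℝ) := by
    rw [Nat.card_sigma]; push_cast; rfl
  have step3 : ∑ y : Y, (Nat.card (Z y) : ℝ) = ∑ s ∈ Finset.range (R + 1),
      ∑ y ∈ Finset.univ.filter (fun y : Y => y.1.rank = s), (Nat.card (Z y) : ℝ) := by
    rw [Finset.sum_fiberwise_of_maps_to]
    intro y _
    have := y.2.1
    simp; omega
  have step4 : ∀ s ∈ Finset.range (R + 1),
      ∑ y ∈ Finset.univ.filter (fun y : Y => y.1.rank = s), (Nat.card (Z y) : ℝ) ≤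
        16 * q ^ E * q ^ (-((s : ℝ) - x) ^ 2) := by
    intro s hs
    by_cases hrs : N.rank ≤ s
    swap
    · rw [Finset.filter_false_of_mem]
      · simp only [Finset.sum_empty]; positivity
      · rintro y - h
        apply hrs
        rw [← y.2.2, ← h]
        exact Matrix.rank_submatrix_le _ _ _
    obtain ⟨d, rfl⟩ := Nat.exists_eq_add_of_le hrs
    obtain ⟨t, ht⟩ := Nat.exists_eq_add_of_le (Nat.lt_succ_iff.1 (Finset.mem_range.1 hs))
    have hc : ((Finset.univ.filter (fun y : Y => y.1.rank = N.rank + d)).card : ℝ) ≤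
        4 * q ^ ((N.rank : ℤ) * i + d * ((b : ℤ) + i - N.rank - d)) := by
      refine le_trans ?_ (row_count q hqF hq i d N)
      rw [← Fintype.card_subtype, ← Nat.card_eq_fintype_card]
      norm_cast
      refine Nat.card_le_card_of_injective (fun y => ⟨y.1.1, y.2, y.1.2.2⟩) ?_
      intro y y' h
      have h2 := congrArg Subtype.val h
      exact Subtype.ext (Subtype.ext h2)
    have hz : ∀ y ∈ Finset.univ.filter (fun y : Y => y.1.rank = N.rank + d),
        (Nat.card (Z y) : ℝ) ≤ 4 * q ^ (((N.rank + d : ℕ) : ℤ) * j +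
          t * (((a + i : ℕ) : ℤ) + j - (N.rank + d : ℕ) - t)) := by
      intro y hy
      have hy' : y.1.rank = N.rank + d := by simpa using hy
      have := col_count q hqF hq j t y.1
      rw [hy', ← ht] at this
      exact this
    refine (Finset.sum_le_card_nsmul _ _ _ hz).trans ?_
    rw [nsmul_eq_mul]
    refine (mul_le_mul_of_nonneg_right hc (by positivity)).trans (le_of_eq ?_)
    rw [mul_mul_mul_comm, ← zpow_add₀ hq0.ne', mul_assoc (16 : ℝ), ← Real.rpow_add hq0,
      ← Real.rpow_intCast, show (4 : ℝ) * 4 = 16 by norm_num]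
    congr 2
    rw [hE, hx, ht]
    push_cast
    ring
  calc _ ≤ (Nat.card (Σ y : Y, Z y) : ℝ) := by exact_mod_cast step1
    _ ≤ ∑ s ∈ Finset.range (R + 1), 16 * q ^ E * q ^ (-((s : ℝ) - x) ^ 2) := by
      rw [step2, step3]; exact Finset.sum_le_sum step4
    _ = 16 * q ^ E * ∑ s ∈ Finset.range (R + 1), q ^ (-((s : ℝ) - x) ^ 2) := by
      rw [Finset.mul_sum]
    _ ≤ 16 * q ^ E * T := mul_le_mul_of_nonneg_left (hT _ _) (by positivity)
    _ = _ := by ring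

/-- The number `E^{A,B,R}_{a,b,r}` of rank-`R` matrices of size `A×B` over
`Z_D` extending a fixed rank-`r` matrix of size `a×b` in the upper-left corner satisfies
`E^{A,B,R}_{a,b,r} = O(1)·D^{(A+B−b)R − br − R² + (b−a+r+R)²/4}`. -/
theorem count_rank_extensions_bound
    {D : ℕ} [Fact D.Prime] :
    ∃ K : ℝ, 0 < K ∧
      ∀ (A B a b r R : ℕ) (ha : a ≤ A) (hb : b ≤ B), r ≤ R →
        ∀ N : Matrix (Fin a) (Fin b) (ZMod D), N.rank = r →
          (Nat.card {M : Matrix (Fin A) (Fin B) (ZMod D) //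
              M.rank = R ∧ M.submatrix (Fin.castLE ha) (Fin.castLE hb) = N} : ℝ) ≤
            K * (D : ℝ) ^
              (((A : ℝ) + B - b) * R - (b : ℝ) * r - (R : ℝ) ^ 2 +
                ((b : ℝ) - a + r + R) ^ 2 / 4) := by
  have hq : (2 : ℝ) ≤ (D : ℝ) := by exact_mod_cast (Fact.out : D.Prime).two_le
  obtain ⟨T, hT0, hT⟩ := rpow_sum_bound (D : ℝ) hq
  refine ⟨16 * T, by positivity, ?_⟩
  intro A B a b r R ha hb hrR N hN
  obtain ⟨i, rfl⟩ := Nat.exists_eq_add_of_le ha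
  obtain ⟨j, rfl⟩ := Nat.exists_eq_add_of_le hb
  subst hN
  exact main_count (F := ZMod D) (D : ℝ) (by rw [ZMod.card]) hq T hT a b i j R N
end

section
/- For every sufficiently large n there exist CSS codes over qudits of odd prime dimension D with parameters [[2n², 2ρ²n², ≥ cn²]] and all stabilizer generator weights at most 2n, for some universal constants ρ, c > 0 (depending only on D). -/
open Matrix

namespace QHP

section det
variable {F : Type*} [Field F] {κ ι : Type*} [Fintype κ] [Fintype ι]

/-- Uniform low weight property. -/
def Unif (h : ℕ) (H H' : Matrix κ ι F) : Prop :=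
  ∀ (S T : Finset ι) (Y : Matrix ι ι F), S.card ≤ h → T.card ≤ h → H * Y * H'ᵀ = 0 →
    (∀ i, i ∉ S → {j | j ∉ T ∧ Y i j ≠ 0}.ncard ≤ h) →
    (∀ j, j ∉ T → {i | i ∉ S ∧ Y i j ≠ 0}.ncard ≤ h) →
    ∀ i, i ∉ S → ∀ j, j ∉ T → Y i j = 0

lemma Unif.dist_left [DecidableEq ι] [Nonempty ι] {h : ℕ} (hh : 1 ≤ h) {H H' : Matrix κ ι F}
    (hU : Unif h H H')
    (v : ι → F) (hv : H *ᵥ v = 0) (hw : {i | v i ≠ 0}.ncard ≤ h) : v = 0 := by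
  obtain ⟨j0⟩ := ‹Nonempty ι›
  have := hU ∅ ∅ (Matrix.of fun i j => if j = j0 then v i else 0) (by simp) (by simp) ?_ ?_ ?_
  · funext i
    simpa using this i (by simp) j0 (by simp)
  · have : H * (Matrix.of fun i j => if j = j0 then v i else 0) = 0 := by
      ext a j
      have := congrFun hv a
      by_cases hj : j = j0
      · simpa [Matrix.mul_apply, hj, Matrix.mulVec, dotProduct] using this
      · simp [Matrix.mul_apply, hj]
    rw [this, Matrix.zero_mul]
  · intro i _
    refine le_trans (Set.ncard_le_ncard (t := {j0}) ?_) (by simpa using hh)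
    intro j hj
    by_contra hne
    simp at hj hne
    exact hne hj.1
  · intro j _
    refine le_trans (Set.ncard_le_ncard (t := {i | v i ≠ 0}) ?_) hw
    intro i hi
    simp at hi ⊢
    exact hi.2

lemma Unif.swap {h : ℕ} {H H' : Matrix κ ι F} (hU : Unif h H H') : Unif h H' H := by
  intro S T Y hS hT hY h1 h2 i hi j hj
  refine hU T S Yᵀ hT hS ?_ ?_ ?_ j hj i hi
  · have := congrArg Matrix.transpose hY
    simpa [Matrix.transpose_mul, Matrix.mul_assoc] using this
  · intro i hi; exact h2 i hi
  · intro i hi; exact h1 i hi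

/-- small column sets can be inverted -/
lemma exists_local_inv [DecidableEq ι] [DecidableEq κ] {h : ℕ} {H : Matrix κ ι F}
    (hd : ∀ v : ι → F, H *ᵥ v = 0 → {i | v i ≠ 0}.ncard ≤ h → v = 0)
    (S : Finset ι) (hS : S.card ≤ h) :
    ∃ Γ : Matrix ι κ F, (∀ i, i ∉ S → ∀ k, Γ i k = 0) ∧
      ∀ i ∈ S, ∀ j ∈ S, (Γ * H) i j = if i = j then 1 else 0 := by
  let HS : Matrix κ S F := H.submatrix id (fun s => s.1)
  have hinj : LinearMap.ker HS.mulVecLin = ⊥ := by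
    rw [LinearMap.ker_eq_bot']
    intro v hv
    let w : ι → F := fun i => if hi : i ∈ S then v ⟨i, hi⟩ else 0
    have hw : w = 0 := by
      apply hd
      · rw [← hv]
        funext k
        simp only [Matrix.mulVec, dotProduct, w, HS, Matrix.mulVecLin_apply, Matrix.submatrix_apply,
          id]
        rw [← Finset.sum_subset (Finset.subset_univ S), ← Finset.sum_coe_sort]
        · apply Finset.sum_congr rfl
          intro i _
          simp
        · intro i _ hi
          simp [hi]
      · refine le_trans (Set.ncard_le_ncard (t := (S : Set ι)) ?_) (by simpa using hS)
        intro i hi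
        by_contra hne
        simp at hne
        simp [w, hne] at hi
    funext s
    have := congrFun hw s.1
    simpa [w] using this
  obtain ⟨g, hg⟩ := LinearMap.exists_leftInverse_of_injective _ hinj
  refine ⟨Matrix.of fun i k => if hi : i ∈ S then g (Pi.single k 1) ⟨i, hi⟩ else 0, ?_, ?_⟩
  · intro i hi k
    simp [hi]
  · intro i hi j hj
    have h1 : g (HS *ᵥ (Pi.single ⟨j, hj⟩ 1)) = Pi.single ⟨j, hj⟩ 1 := by
      have := LinearMap.congr_fun hg (Pi.single ⟨j, hj⟩ 1)
      simpa using this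
    have h2 : HS *ᵥ (Pi.single ⟨j, hj⟩ 1) = ∑ k, H k j • (Pi.single k (1:F) : κ → F) := by
      funext k
      simp [HS, Matrix.mulVec_single, Finset.sum_apply, Pi.single_apply]
    rw [h2, map_sum] at h1
    have h3 := congrFun h1 ⟨i, hi⟩
    simp only [map_smul, Finset.sum_apply, Pi.smul_apply, smul_eq_mul] at h3
    simp only [Matrix.mul_apply, Matrix.of_apply, hi, dite_true]
    rw [← Finset.sum_congr rfl (fun k _ => mul_comm (H k j) _), h3, Pi.single_apply]
    simp

lemma heavy_rows {h : ℕ} (Y : Matrix ι ι F)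
    (hw : {p : ι × ι | Y p.1 p.2 ≠ 0}.ncard ≤ h ^ 2) :
    ∃ S : Finset ι, S.card ≤ h ∧ ∀ i, i ∉ S → {j | Y i j ≠ 0}.ncard ≤ h := by
  classical
  refine ⟨Finset.univ.filter fun i => h < {j | Y i j ≠ 0}.ncard, ?_, ?_⟩
  · set S := Finset.univ.filter fun i => h < {j | Y i j ≠ 0}.ncard
    have h1 : S.card * (h+1) ≤ {p : ι × ι | Y p.1 p.2 ≠ 0}.ncard := by
      have e : {p : ι × ι | Y p.1 p.2 ≠ 0}.ncard = ∑ i, {j | Y i j ≠ 0}.ncard := by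
        simp only [Set.ncard_eq_toFinset_card', Set.toFinset_ofPred]
        rw [Finset.card_filter, Fintype.sum_prod_type]
        simp [Finset.card_filter]
      rw [e]
      calc S.card * (h+1) = ∑ i ∈ S, (h+1) := by simp
        _ ≤ ∑ i ∈ S, {j | Y i j ≠ 0}.ncard := by
          apply Finset.sum_le_sum
          intro i hi
          simp only [S, Finset.mem_filter] at hi
          exact hi.2
        _ ≤ _ := Finset.sum_le_sum_of_subset (Finset.subset_univ _)
    by_contra hc
    nlinarith
  · intro i hi
    simpa using hi

lemma det_main [Nonempty ι] [DecidableEq ι] [DecidableEq κ] {h : ℕ} (hh : 1 ≤ h)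
    {H G H' G' : Matrix κ ι F} (hU : Unif h H H')
    (hHG : H * Gᵀ = 0) (hHG' : H' * G'ᵀ = 0)
    {R R' : Matrix ι κ F} (hR : G * R = 1) (hR' : G' * R' = 1)
    (Y : Matrix ι ι F) (X W : Matrix κ κ F)
    (h1 : Y * H'ᵀ + Gᵀ * X = 0) (h2 : H * Y + W * G' = 0)
    (hw : {p : ι × ι | Y p.1 p.2 ≠ 0}.ncard ≤ h ^ 2) :
    ∃ (P : Matrix κ ι F) (Q : Matrix ι κ F), Y = Gᵀ * P + Q * G' ∧ X = -(P * H'ᵀ) ∧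
      W = -(H * Q) := by
  obtain ⟨S, hS, hS'⟩ := heavy_rows Y hw
  obtain ⟨T, hT, hT'⟩ := heavy_rows Yᵀ (h := h) (by
    refine le_trans (le_of_eq ?_) hw
    have : {p : ι × ι | Yᵀ p.1 p.2 ≠ 0} = Prod.swap '' {p : ι × ι | Y p.1 p.2 ≠ 0} := by
      ext ⟨a, b⟩
      simp
    rw [this, Set.ncard_image_of_injective _ Prod.swap_injective])
  have hYH : Y * H'ᵀ = -(Gᵀ * X) := eq_neg_of_add_eq_zero_left h1
  have hHY : H * Y = -(W * G') := eq_neg_of_add_eq_zero_left h2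
  have hz : ∀ i, i ∉ S → ∀ j, j ∉ T → Y i j = 0 := by
    refine hU S T Y hS hT ?_ ?_ ?_
    · rw [Matrix.mul_assoc, hYH, Matrix.mul_neg, ← Matrix.mul_assoc, hHG]; simp
    · intro i hi
      exact le_trans (Set.ncard_le_ncard fun j hj => hj.2) (hS' i hi)
    · intro i hi
      exact le_trans (Set.ncard_le_ncard fun j hj => hj.2) (hT' i hi)
  obtain ⟨Γ', hΓ0', hΓ'⟩ := exists_local_inv (hU.swap.dist_left hh) T hT
  obtain ⟨Γ, hΓ0, hΓ⟩ := exists_local_inv (hU.dist_left hh) S hS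
  -- E
  set P : Matrix κ ι F := -(X * Γ'ᵀ) with hP
  have hE : Gᵀ * P = Y * (Γ' * H')ᵀ := by
    rw [hP, Matrix.transpose_mul, ← Matrix.mul_assoc, hYH]
    simp [Matrix.mul_assoc]
  have hEY : ∀ i, i ∉ S → ∀ j, (Gᵀ * P) i j = Y i j := by
    intro i hi j
    rw [hE, Matrix.mul_apply]
    by_cases hj : j ∈ T
    · rw [Finset.sum_eq_single j]
      · simp [hΓ' j hj j hj]
      · intro t _ htj
        by_cases ht : t ∈ T
        · simp [hΓ' j hj t ht, htj.symm]
        · simp [hz i hi t ht]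
      · simp
    · rw [hz i hi j hj]
      apply Finset.sum_eq_zero
      intro t _
      have : (Γ' * H') j t = 0 := by
        simp [Matrix.mul_apply, hΓ0' j hj]
      simp [this]
  set Q : Matrix ι κ F := -(Γ * W) with hQ
  have hF : Y - Gᵀ * P = Q * G' := by
    have hHF : H * (Y - Gᵀ * P) = -(W * G') := by
      rw [Matrix.mul_sub, hHY, ← Matrix.mul_assoc, hHG]; simp
    have : Q * G' = (Γ * H) * (Y - Gᵀ * P) := by
      rw [Matrix.mul_assoc, hHF, hQ]; simp [Matrix.mul_assoc]
    rw [this]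
    ext i j
    rw [Matrix.mul_apply]
    by_cases hi : i ∈ S
    · rw [Finset.sum_eq_single i]
      · simp [hΓ i hi i hi]
      · intro t _ hti
        by_cases ht : t ∈ S
        · simp [hΓ i hi t ht, hti.symm]
        · simp [hEY t ht j]
      · simp
    · rw [Matrix.sub_apply, hEY i hi j, sub_self]
      symm
      apply Finset.sum_eq_zero
      intro t _
      have : (Γ * H) i t = 0 := by
        simp [Matrix.mul_apply, hΓ0 i hi]
      simp [this]
  have hY : Y = Gᵀ * P + Q * G' := by rw [← hF]; abel
  refine ⟨P, Q, hY, ?_, ?_⟩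
  · have hGH' : G' * H'ᵀ = 0 := by
      have := congrArg Matrix.transpose hHG'
      simpa [Matrix.transpose_mul] using this
    have h3 : Gᵀ * (P * H'ᵀ) = Gᵀ * (-X) := by
      rw [Matrix.mul_neg, ← hYH, hY, Matrix.add_mul, Matrix.mul_assoc Q, hGH', Matrix.mul_assoc]
      simp
    have h4 := congrArg (fun M => Rᵀ * M) h3
    have hRG : Rᵀ * Gᵀ = 1 := by rw [← Matrix.transpose_mul, hR, Matrix.transpose_one]
    simp only [← Matrix.mul_assoc, hRG, Matrix.one_mul] at h4
    rw [h4, neg_neg]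
  · have h3 : (H * Q) * G' = (-W) * G' := by
      rw [Matrix.neg_mul, ← hHY, hY, Matrix.mul_add, ← Matrix.mul_assoc H Gᵀ, hHG,
        Matrix.mul_assoc]
      simp
    have h4 := congrArg (fun M => M * R') h3
    simp only [Matrix.mul_assoc _ G', hR', Matrix.mul_one] at h4
    rw [h4, neg_neg]

end det
end QHP

namespace QHP

section count

lemma ncard_preimage_mul {V W : Type*} [AddCommGroup V] [AddCommGroup W] [Finite V] [Finite W]
    (f : V →+ W) (hf : Function.Surjective f) (P : Set W) :
    (f ⁻¹' P).ncard * Nat.card W = P.ncard * Nat.card V := by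
  let s := Function.surjInv hf
  have hs : ∀ w, f (s w) = w := Function.surjInv_eq hf
  let e : V ≃ W × f.ker :=
    { toFun := fun v => (f v, ⟨v - s (f v), by simp [AddMonoidHom.mem_ker, hs]⟩)
      invFun := fun p => s p.1 + p.2.1
      left_inv := fun v => by simp
      right_inv := fun ⟨w, k, hk⟩ => by
        have hk' : f k = 0 := hk
        ext <;> simp [hs, hk'] }
  have h1 : Nat.card V = Nat.card W * Nat.card f.ker := by
    rw [Nat.card_congr e, Nat.card_prod]
  have h2 : (f ⁻¹' P).ncard = P.ncard * Nat.card f.ker := by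
    have : f ⁻¹' P = e.symm '' (P ×ˢ (Set.univ : Set f.ker)) := by
      rw [Equiv.image_symm_eq_preimage]
      ext v
      simp [e]
    rw [this, Set.ncard_image_of_injective _ e.symm.injective, Set.ncard_prod, Set.ncard_univ]
  rw [h1, h2]; ring

lemma ncard_le_of_subset_range {A B : Type*} [Finite A] {s : Set B} (g : A → B)
    (h : ∀ b ∈ s, ∃ a, g a = b) : s.ncard ≤ Nat.card A := by
  calc s.ncard ≤ (g '' Set.univ).ncard :=
        Set.ncard_le_ncard (fun b hb => by obtain ⟨a, ha⟩ := h b hb; exact ⟨a, trivial, ha⟩)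
          (Set.toFinite _)
    _ ≤ (Set.univ : Set A).ncard := Set.ncard_image_le (Set.toFinite _)
    _ = _ := Set.ncard_univ _

variable {F : Type*} [Field F] [Fintype F]

lemma card_mat (m n : Type*) [Fintype m] [Fintype n] :
    Nat.card (Matrix m n F) = Fintype.card F ^ (Fintype.card m * Fintype.card n) := by
  classical
  have : Nat.card (Matrix m n F) = Nat.card (m → n → F) := rfl
  rw [this]
  simp [← pow_mul, mul_comm]

/-- a matrix with injective `mulVec` has a left inverse -/
lemma exists_left_inv {m n : Type*} [Fintype m] [Fintype n] [DecidableEq m] [DecidableEq n]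
    (A : Matrix m n F) (hA : LinearIndependent F A.col) : ∃ B : Matrix n m F, B * A = 1 := by
  have h := Matrix.mulVec_injective_iff.2 hA
  obtain ⟨g, hg⟩ := LinearMap.exists_leftInverse_of_injective A.mulVecLin
    (LinearMap.ker_eq_bot.2 h)
  refine ⟨LinearMap.toMatrix' g, ?_⟩
  have := congrArg LinearMap.toMatrix' hg
  rw [LinearMap.toMatrix'_comp, LinearMap.toMatrix'_id] at this
  rw [← this]
  congr 1
  exact (LinearMap.toMatrix'_toLin' A).symm

lemma small_or_large {κ τ ρ : Type*} [Fintype κ] [Fintype τ] [Fintype ρ] [DecidableEq κ]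
    [DecidableEq τ] [DecidableEq ρ] (A : Matrix κ τ F) (B : Matrix κ ρ F) (t : ℕ) :
    (∃ (X : Matrix τ ρ F) (U : Matrix κ (Fin t) F) (V : Matrix (Fin t) ρ F), B = A * X + U * V) ∨
    (∃ (μ : Matrix κ (Fin (t+1)) F) (N : Matrix (Fin (t+1)) ρ F), Aᵀ * μ = 0 ∧
      N * (Bᵀ * μ) = 1) := by
  set a := Aᵀ.mulVecLin with ha
  set b := Bᵀ.mulVecLin with hb
  set D := (LinearMap.ker a).map b with hD
  by_cases hd : Module.finrank F D ≤ t
  · left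
    obtain ⟨π, hπ⟩ := LinearMap.exists_leftInverse_of_injective (LinearMap.ker a).subtype (by simp)
    have hrank : ∃ i : D →ₗ[F] (Fin t → F), Function.Injective i := by
      rw [← finrank_le_iff_exists_linearMap]
      simpa using hd
    obtain ⟨i, hi⟩ := hrank
    obtain ⟨i', hi'⟩ := LinearMap.exists_leftInverse_of_injective i (LinearMap.ker_eq_bot.2 hi)
    -- restriction of b to ker, landing in D
    let bD : LinearMap.ker a →ₗ[F] D :=
      (b.comp (LinearMap.ker a).subtype).codRestrict D (fun x => ⟨x.1, x.2, rfl⟩)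
    let p : (κ → F) →ₗ[F] (Fin t → F) := i.comp (bD.comp π)
    let p' : (Fin t → F) →ₗ[F] (ρ → F) := D.subtype.comp i'
    let b2 := b - p'.comp p
    have hpp : ∀ v, p' (p v) = b (π v).1 := by
      intro v
      have := LinearMap.congr_fun hi' (bD (π v))
      simp only [LinearMap.comp_apply, LinearMap.id_apply] at this
      simp only [p', p, LinearMap.comp_apply, this]
      rfl
    have hb2 : ∀ v ∈ LinearMap.ker a, b2 v = 0 := by
      intro v hv
      have := LinearMap.congr_fun hπ ⟨v, hv⟩
      simp only [LinearMap.comp_apply, LinearMap.id_apply, Submodule.subtype_apply] at this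
      simp [b2, hpp, this]
    obtain ⟨g0, hg0⟩ := LinearMap.exists_rightInverse_of_surjective a.rangeRestrict
      (LinearMap.range_rangeRestrict a)
    obtain ⟨g, hg⟩ := LinearMap.exists_extend g0
    let x := b2.comp g
    have hx : ∀ v, b2 v = x (a v) := by
      intro v
      have h1 : g (a v) = g0 (a.rangeRestrict v) := by
        have := LinearMap.congr_fun hg (a.rangeRestrict v)
        simpa using this
      have h2 : a (g (a v)) = a v := by
        rw [h1]
        have := LinearMap.congr_fun hg0 (a.rangeRestrict v)
        simpa using congrArg Subtype.val this
      have h3 : b2 (v - g (a v)) = 0 := hb2 _ (by simp [LinearMap.mem_ker, h2])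
      rw [map_sub, sub_eq_zero] at h3
      exact h3
    have hfin : b = x.comp a + p'.comp p := by
      ext1 v
      have := hx (Pi.single v 1)
      ext j
      simp only [LinearMap.comp_apply, LinearMap.add_apply, LinearMap.single_apply]
      rw [← this]
      simp [b2]
    have hm := congrArg LinearMap.toMatrix' hfin
    rw [map_add, LinearMap.toMatrix'_comp x a, LinearMap.toMatrix'_comp p' p, ha, hb,
      ← Matrix.toLin'_apply', ← Matrix.toLin'_apply', LinearMap.toMatrix'_toLin',
      LinearMap.toMatrix'_toLin'] at hm
    refine ⟨(LinearMap.toMatrix' x)ᵀ, (LinearMap.toMatrix' p)ᵀ, (LinearMap.toMatrix' p')ᵀ, ?_⟩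
    have := congrArg Matrix.transpose hm
    rw [Matrix.transpose_add, Matrix.transpose_mul, Matrix.transpose_mul, Matrix.transpose_transpose,
      Matrix.transpose_transpose] at this
    exact this
  · right
    push Not at hd
    let bas := Module.finBasis F D
    let w : Fin (t+1) → D := fun i => bas (Fin.castLE hd i)
    have hw : LinearIndependent F (fun i => (w i : ρ → F)) := by
      have : LinearIndependent F w := bas.linearIndependent.comp _ (Fin.castLE_injective hd)
      exact this.map' D.subtype (by simp)
    have hμ : ∀ i, ∃ v, a v = 0 ∧ b v = w i := by
      intro i
      obtain ⟨v, hv, hv'⟩ := (w i).2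
      exact ⟨v, hv, hv'⟩
    choose μ hμa hμb using hμ
    have hcol : LinearIndependent F (Bᵀ * (Matrix.of μ)ᵀ).col := by
      convert hw using 1
      funext i j
      have := congrFun (hμb i) j
      rw [← this]
      simp [hb, Matrix.mul_apply, Matrix.vecMul, dotProduct, Matrix.col, mul_comm]
    obtain ⟨N, hN⟩ := exists_left_inv _ hcol
    refine ⟨(Matrix.of μ)ᵀ, N, ?_, hN⟩
    ext j i
    have := congrFun (hμa i) j
    simpa [ha, Matrix.mul_apply, Matrix.vecMul, dotProduct, mul_comm] using this

lemma exists_factor {ι : Type*} [Fintype ι] [DecidableEq ι] (Y : Matrix ι ι F) {r : ℕ}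
    (hr : Y.rank = r) :
    ∃ (C : Matrix ι (Fin r) F) (K : Matrix (Fin r) ι F) (C' : Matrix (Fin r) ι F)
      (K' : Matrix ι (Fin r) F), Y = C * K ∧ C' * C = 1 ∧ K * K' = 1 ∧
      (∀ i, (∀ j, Y i j = 0) → ∀ k, C i k = 0) ∧ (∀ j, (∀ i, Y i j = 0) → ∀ k, K k j = 0) := by
  let D := LinearMap.range Y.mulVecLin
  have hD : Module.finrank F D = r := hr
  let bas : Module.Basis (Fin r) F D := Module.finBasisOfFinrankEq F D hD
  let C : Matrix ι (Fin r) F := Matrix.of fun i k => (bas k : ι → F) i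
  have hcol : LinearIndependent F C.col := by
    have : LinearIndependent F (fun k => (bas k : ι → F)) :=
      bas.linearIndependent.map' D.subtype (by simp)
    exact this
  obtain ⟨C', hC'⟩ := exists_left_inv C hcol
  let K : Matrix (Fin r) ι F := C' * Y
  have hz : ∀ k, ∃ z, Y *ᵥ z = (bas k : ι → F) := fun k => (bas k).2
  choose z hz using hz
  have hYz : Y * (Matrix.of z)ᵀ = C := by
    ext i k
    have := congrFun (hz k) i
    simpa [Matrix.mul_apply, Matrix.mulVec, dotProduct, C] using this
  have hY : Y = C * K := by
    -- columns of Y are combos of C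
    have : ∃ M : Matrix (Fin r) ι F, Y = C * M := by
      let c : ι → D := fun j => ⟨Y *ᵥ Pi.single j 1, ⟨_, rfl⟩⟩
      refine ⟨Matrix.of fun k j => bas.repr (c j) k, ?_⟩
      ext i j
      have h1 := bas.sum_repr (c j)
      have h2 := congrFun (congrArg Subtype.val h1) i
      simp only [Submodule.coe_sum, Submodule.coe_smul, Finset.sum_apply, Pi.smul_apply,
        smul_eq_mul] at h2
      simp only [Matrix.mul_apply, Matrix.of_apply, C]
      have h3 : (c j : ι → F) i = Y i j := by simp [c]
      rw [← h3, ← h2]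
      exact Finset.sum_congr rfl fun k _ => mul_comm _ _
    obtain ⟨M, hM⟩ := this
    have : K = M := by
      simp only [K, hM]
      rw [← Matrix.mul_assoc, hC', Matrix.one_mul]
    rw [this]; exact hM
  refine ⟨C, K, C', (Matrix.of z)ᵀ, hY, hC', ?_, ?_, ?_⟩
  · simp only [K]; rw [Matrix.mul_assoc, hYz, hC']
  · intro i hi k
    rw [← hYz]; simp [Matrix.mul_apply, hi]
  · intro j hj k
    simp [K, Matrix.mul_apply, hj]

end count
end QHP

namespace QHP

section countB

lemma ncard_le_fiber {α β : Type*} [Finite α] [Finite β] (s : Set (α × β)) (K : ℕ)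
    (hK : ∀ y, {x | (x, y) ∈ s}.ncard ≤ K) : s.ncard ≤ Nat.card β * K := by
  classical
  haveI := Fintype.ofFinite β
  have h1 : s ⊆ ⋃ y ∈ (Finset.univ : Finset β), ({x | (x, y) ∈ s} ×ˢ {y}) := by
    rintro ⟨x, y⟩ h
    simp [h]
  calc s.ncard ≤ _ := Set.ncard_le_ncard h1 (Set.toFinite _)
    _ ≤ ∑ y : β, ({x | (x, y) ∈ s} ×ˢ ({y} : Set β)).ncard := Finset.set_ncard_biUnion_le _ _
    _ ≤ ∑ y : β, K := by
        apply Finset.sum_le_sum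
        intro y _
        rw [Set.ncard_prod, Set.ncard_singleton, mul_one]
        exact hK y
    _ = _ := by simp

variable {F : Type*} [Field F] [Fintype F]

lemma bad_quads {κ σ τ : Type*} [Fintype κ] [Fintype σ] [Fintype τ] [DecidableEq κ]
    [DecidableEq σ] [DecidableEq τ] {h r : ℕ} (hκ : Fintype.card κ = 2048 * h)
    (hσ : Fintype.card σ ≤ h) (hτ : Fintype.card τ ≤ h) (hr : r ≤ 4 * Fintype.card κ) :
    {x : (Matrix κ σ F × Matrix κ (Fin r) F) × (Matrix κ τ F × Matrix κ (Fin r) F) |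
      ∃ (X : Matrix σ κ F) (X' : Matrix κ τ F),
        x.1.2 * x.2.2ᵀ = x.1.1 * X + X' * x.2.1ᵀ}.ncard * Fintype.card F ^ (128 * h * r) ≤
    2 * Nat.card ((Matrix κ σ F × Matrix κ (Fin r) F) × (Matrix κ τ F × Matrix κ (Fin r) F)) := by
  set q := Fintype.card F with hq
  have hq1 : 1 ≤ q := Fintype.card_pos
  set m := Fintype.card κ with hm
  set a := Fintype.card σ with ha
  set a' := Fintype.card τ with ha'
  set t := r / 8 with ht
  have ht1 : 8 * t ≤ r := Nat.mul_div_le r 8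
  have ht2 : r ≤ 8 * (t + 1) := by omega
  set Bad := {x : (Matrix κ σ F × Matrix κ (Fin r) F) × (Matrix κ τ F × Matrix κ (Fin r) F) |
      ∃ (X : Matrix σ κ F) (X' : Matrix κ τ F),
        x.1.2 * x.2.2ᵀ = x.1.1 * X + X' * x.2.1ᵀ} with hBad
  let Small : Set (Matrix κ τ F × Matrix κ (Fin r) F) :=
    {y | ∃ (X : Matrix τ (Fin r) F) (U : Matrix κ (Fin t) F) (V : Matrix (Fin t) (Fin r) F),
      y.2 = y.1 * X + U * V}
  have hSmall : Small.ncard ≤ q ^ (m * a' + (a' * r + (m * t + t * r))) := by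
    have := ncard_le_of_subset_range (s := Small)
      (A := Matrix κ τ F × Matrix τ (Fin r) F × Matrix κ (Fin t) F × Matrix (Fin t) (Fin r) F)
      (fun z => (z.1, z.1 * z.2.1 + z.2.2.1 * z.2.2.2)) (by
        rintro ⟨A, B⟩ ⟨X, U, V, h⟩
        exact ⟨(A, X, U, V), by simp at h; simp [h]⟩)
    refine this.trans (le_of_eq ?_)
    simp only [Nat.card_prod, card_mat, Fintype.card_fin, ← pow_add, hq, hm, ha']
  have hcard1 : Nat.card (Matrix κ σ F × Matrix κ (Fin r) F) = q ^ (m * a + m * r) := by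
    simp only [Nat.card_prod, card_mat, Fintype.card_fin, ← pow_add, hq, hm, ha]
  have hcard2 : Nat.card (Matrix κ τ F × Matrix κ (Fin r) F) = q ^ (m * a' + m * r) := by
    simp only [Nat.card_prod, card_mat, Fintype.card_fin, ← pow_add, hq, hm, ha']
  -- the part with small right half
  have hp1 : (Bad ∩ {x | x.2 ∈ Small}).ncard * q ^ (128 * h * r) ≤
      q ^ (m * a + m * r) * q ^ (m * a' + m * r) := by
    have h1 : (Bad ∩ {x | x.2 ∈ Small}).ncard ≤ q ^ (m * a + m * r) * Small.ncard := by
      have : Bad ∩ {x | x.2 ∈ Small} ⊆ Set.univ ×ˢ Small := by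
        rintro x ⟨_, hx⟩
        exact ⟨trivial, hx⟩
      refine (Set.ncard_le_ncard this (Set.toFinite _)).trans ?_
      rw [Set.ncard_prod, Set.ncard_univ, hcard1]
    calc _ ≤ (q ^ (m * a + m * r) * q ^ (m * a' + (a' * r + (m * t + t * r)))) *
            q ^ (128 * h * r) := by gcongr; exact h1.trans (by gcongr)
      _ = q ^ (m * a + m * r) * q ^ (m * a' + (a' * r + (m * t + t * r)) + 128 * h * r) := by
          rw [mul_assoc, ← pow_add]
      _ ≤ _ := by
          gcongr _ * ?_
          apply Nat.pow_le_pow_right hq1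
          have e1 : a' * r ≤ h * r := Nat.mul_le_mul_right _ hτ
          have e2 : t * r ≤ 4 * (m * t) := by nlinarith
          have e3 : 8 * (m * t) ≤ m * r := by nlinarith
          have e4 : m * r = 2048 * (h * r) := by rw [hκ]; ring
          have e5 : 128 * h * r = 128 * (h * r) := by ring
          omega
  have hp2 : (Bad ∩ {x | x.2 ∉ Small}).ncard * q ^ (128 * h * r) ≤
      q ^ (m * a + m * r) * q ^ (m * a' + m * r) := by
    have hfib : ∀ y, {x | (x, y) ∈ Bad ∩ {x | x.2 ∉ Small}}.ncard * q ^ (128 * h * r) ≤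
        q ^ (m * a + m * r) := by
      intro y
      by_cases hy : y ∈ Small
      · have : {x | (x, y) ∈ Bad ∩ {x | x.2 ∉ Small}} = ∅ := by
          ext x; simp [hy]
        rw [this]; simp
      · obtain hs | ⟨μ, N, hμ, hN⟩ := small_or_large y.1 y.2 t
        · exact absurd hs hy
        let f : (Matrix κ σ F × Matrix κ (Fin r) F) →+ (Matrix κ σ F × Matrix κ (Fin (t+1)) F) :=
          AddMonoidHom.mk' (fun x => (x.1, x.2 * (y.2ᵀ * μ))) (by
            intro x x'
            exact Prod.ext rfl (Matrix.add_mul _ _ _))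
        have hf : Function.Surjective f := by
          rintro ⟨A, D⟩
          refine ⟨(A, D * N), ?_⟩
          refine Prod.ext rfl ?_
          change D * N * (y.2ᵀ * μ) = D
          rw [Matrix.mul_assoc, hN, Matrix.mul_one]
        let P : Set (Matrix κ σ F × Matrix κ (Fin (t+1)) F) := {z | ∃ Z : Matrix σ (Fin (t+1)) F, z.2 = z.1 * Z}
        have hP : P.ncard ≤ q ^ (m * a + a * (t + 1)) := by
          have := ncard_le_of_subset_range (s := P)
            (A := Matrix κ σ F × Matrix σ (Fin (t+1)) F) (fun z => (z.1, z.1 * z.2)) (by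
              rintro ⟨A, D⟩ ⟨Z, hZ⟩
              exact ⟨(A, Z), Prod.ext rfl hZ.symm⟩)
          refine this.trans (le_of_eq ?_)
          simp only [Nat.card_prod, card_mat, Fintype.card_fin, ← pow_add, hq, hm, ha]
        have hsub : {x | (x, y) ∈ Bad ∩ {x | x.2 ∉ Small}} ⊆ f ⁻¹' P := by
          rintro x ⟨⟨X, X', hX⟩, _⟩
          refine ⟨X * μ, ?_⟩
          simp only [f, AddMonoidHom.mk'_apply]
          simp only at hX
          rw [← Matrix.mul_assoc, hX, Matrix.add_mul, Matrix.mul_assoc X', hμ, Matrix.mul_assoc]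
          simp
        have hcount := ncard_preimage_mul f hf P
        have hcW : Nat.card (Matrix κ σ F × Matrix κ (Fin (t+1)) F) =
            q ^ (m * a + m * (t + 1)) := by
          simp only [Nat.card_prod, card_mat, Fintype.card_fin, ← pow_add, hq, hm, ha]
        rw [hcW, hcard1] at hcount
        have hle := Set.ncard_le_ncard hsub (Set.toFinite _)
        set c := {x | (x, y) ∈ Bad ∩ {x | x.2 ∉ Small}}.ncard
        have hexp : 128 * h * r + a * (t + 1) ≤ m * (t + 1) := by
          have e1 : a * (t + 1) ≤ h * (t + 1) := Nat.mul_le_mul_right _ hσ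
          have e2 : h * r ≤ h * (8 * (t + 1)) := Nat.mul_le_mul_left _ ht2
          have e4 : m * (t + 1) = 2048 * (h * (t + 1)) := by rw [hκ]; ring
          have e5 : 128 * h * r = 128 * (h * r) := by ring
          have e6 : h * (8 * (t + 1)) = 8 * (h * (t + 1)) := by ring
          omega
        have hpos : 0 < q ^ (m * a + a * (t + 1)) := by positivity
        refine Nat.le_of_mul_le_mul_right ?_ hpos
        calc c * q ^ (128 * h * r) * q ^ (m * a + a * (t + 1))
            = c * q ^ (m * a + (128 * h * r + a * (t + 1))) := by
              rw [mul_assoc, ← pow_add]; congr 2; ring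
          _ ≤ (f ⁻¹' P).ncard * q ^ (m * a + m * (t + 1)) := by gcongr
          _ = P.ncard * q ^ (m * a + m * r) := hcount
          _ ≤ q ^ (m * a + a * (t + 1)) * q ^ (m * a + m * r) := by gcongr
          _ = _ := mul_comm _ _
    have hpos : 0 < q ^ (128 * h * r) := by positivity
    have := ncard_le_fiber (Bad ∩ {x | x.2 ∉ Small})
      (q ^ (m * a + m * r) / q ^ (128 * h * r)) (by
        intro y
        rw [Nat.le_div_iff_mul_le hpos]
        exact hfib y)
    rw [hcard2] at this
    calc _ ≤ (q ^ (m * a' + m * r) * (q ^ (m * a + m * r) / q ^ (128 * h * r))) *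
          q ^ (128 * h * r) := by gcongr
      _ = q ^ (m * a' + m * r) * ((q ^ (m * a + m * r) / q ^ (128 * h * r)) *
          q ^ (128 * h * r)) := by ring
      _ ≤ q ^ (m * a' + m * r) * q ^ (m * a + m * r) := by
          gcongr; exact Nat.div_mul_le_self _ _
      _ = _ := mul_comm _ _
  have hun : Bad.ncard ≤ (Bad ∩ {x | x.2 ∈ Small}).ncard + (Bad ∩ {x | x.2 ∉ Small}).ncard := by
    refine le_trans (le_of_eq ?_) (Set.ncard_union_le _ _)
    congr 1
    ext x
    by_cases hx : x.2 ∈ Small <;> simp [hx]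
  rw [Nat.card_prod, hcard1, hcard2]
  calc _ ≤ ((Bad ∩ {x | x.2 ∈ Small}).ncard + (Bad ∩ {x | x.2 ∉ Small}).ncard) *
        q ^ (128 * h * r) := by gcongr
    _ ≤ _ := by rw [add_mul]; omega

/-- restriction map -/
def resMap {κ ι : Type*} [Fintype ι] {r : ℕ} (S : Finset ι) (C : Matrix ι (Fin r) F) :
    Matrix κ ι F →+ Matrix κ S F × Matrix κ (Fin r) F :=
  AddMonoidHom.mk' (fun H => (H.submatrix id (fun s : S => s.1), H * C)) (by
    intro x x'
    simp [Matrix.add_mul, Matrix.submatrix_add])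

lemma resMap_surj {κ ι : Type*} [Fintype ι] [DecidableEq ι] {r : ℕ} (S : Finset ι)
    (C : Matrix ι (Fin r) F) (C' : Matrix (Fin r) ι F) (hC : C' * C = 1)
    (hS : ∀ i ∈ S, ∀ k, C i k = 0) : Function.Surjective (resMap (κ := κ) S C) := by
  rintro ⟨A, B⟩
  let C0 : Matrix (Fin r) ι F := Matrix.of fun k i => if i ∈ S then 0 else C' k i
  have hC0 : C0 * C = 1 := by
    rw [← hC]
    ext k l
    simp only [Matrix.mul_apply]
    apply Finset.sum_congr rfl
    intro i _
    by_cases hi : i ∈ S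
    · simp [C0, hi, hS i hi]
    · simp [C0, hi]
  let A0 : Matrix κ ι F := Matrix.of fun k i => if hi : i ∈ S then A k ⟨i, hi⟩ else 0
  have hA0 : A0 * C = 0 := by
    ext k l
    simp only [Matrix.mul_apply]
    apply Finset.sum_eq_zero
    intro i _
    by_cases hi : i ∈ S
    · simp [hS i hi]
    · simp [A0, hi]
  refine ⟨A0 + B * C0, ?_⟩
  simp only [resMap, AddMonoidHom.mk'_apply, Prod.mk.injEq]
  constructor
  · ext k ⟨i, hi⟩
    simp [A0, hi, Matrix.mul_apply, C0]
  · rw [Matrix.add_mul, hA0, Matrix.mul_assoc, hC0]; simp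

lemma event_bound {κ ι : Type*} [Fintype κ] [Fintype ι] [DecidableEq κ]
    [DecidableEq ι] {h r : ℕ} (hκ : Fintype.card κ = 2048 * h)
    (hι : Fintype.card ι = 4 * Fintype.card κ) (S T : Finset ι) (hS : S.card ≤ h) (hT : T.card ≤ h)
    (Y : Matrix ι ι F) (hr : Y.rank = r) (hYS : ∀ i ∈ S, ∀ j, Y i j = 0)
    (hYT : ∀ j ∈ T, ∀ i, Y i j = 0) :
    {x : Matrix κ ι F × Matrix κ ι F | ∃ Z : Matrix ι ι F, x.1 * Z * x.2ᵀ = 0 ∧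
      ∀ i, i ∉ S → ∀ j, j ∉ T → Z i j = Y i j}.ncard * Fintype.card F ^ (128 * h * r) ≤
    2 * Nat.card (Matrix κ ι F × Matrix κ ι F) := by
  obtain ⟨C, K, C', K', hY, hC, hK, hC0, hK0⟩ := exists_factor Y hr
  have hr4 : r ≤ 4 * Fintype.card κ := by
    rw [← hι, ← hr]; exact Matrix.rank_le_card_width Y
  have hB := bad_quads (F := F) (κ := κ) (σ := S) (τ := T) (h := h) (r := r) hκ (by simpa using hS)
    (by simpa using hT) hr4
  let f := (resMap (F := F) (κ := κ) S C).prodMap (resMap (F := F) (κ := κ) T Kᵀ)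
  have hf : Function.Surjective f :=
    Function.Surjective.prodMap
      (resMap_surj S C C' hC (fun i hi k => hC0 i (hYS i hi) k))
      (resMap_surj T Kᵀ K'ᵀ (by rw [← Matrix.transpose_mul, hK, Matrix.transpose_one])
        (fun i hi k => hK0 i (hYT i hi) k))
  set BadQ := {x : (Matrix κ S F × Matrix κ (Fin r) F) × (Matrix κ T F × Matrix κ (Fin r) F) |
      ∃ (X : Matrix S κ F) (X' : Matrix κ T F),
        x.1.2 * x.2.2ᵀ = x.1.1 * X + X' * x.2.1ᵀ} with hBadQ
  have hsub : {x : Matrix κ ι F × Matrix κ ι F | ∃ Z : Matrix ι ι F, x.1 * Z * x.2ᵀ = 0 ∧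
      ∀ i, i ∉ S → ∀ j, j ∉ T → Z i j = Y i j} ⊆ f ⁻¹' BadQ := by
    rintro ⟨H, H'⟩ ⟨Z, hZ, hZY⟩
    simp only at hZ
    let Z1 : Matrix ι ι F := Matrix.of fun i j => if i ∈ S then Z i j else 0
    let Z2 : Matrix ι ι F := Matrix.of fun i j => if i ∈ S then 0 else if j ∈ T then Z i j else 0
    have hdec : Y = Z - Z1 - Z2 := by
      ext i j
      by_cases hi : i ∈ S
      · simp [Z1, Z2, hi, hYS i hi j]
      · by_cases hj : j ∈ T
        · simp [Z1, Z2, hi, hj, hYT j hj i]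
        · simp [Z1, Z2, hi, hj, hZY i hi j hj]
    refine ⟨-((Z1 * H'ᵀ).submatrix (fun s : S => s.1) id),
      -((H * Z2).submatrix id (fun s : T => s.1)), ?_⟩
    have e1 : H * Z1 * H'ᵀ = H.submatrix id (fun s : S => s.1) *
        ((Z1 * H'ᵀ).submatrix (fun s : S => s.1) id) := by
      rw [Matrix.mul_assoc]
      ext k l
      rw [Matrix.mul_apply, Matrix.mul_apply]
      simp only [Matrix.submatrix_apply, id]
      rw [← Finset.sum_subset (Finset.subset_univ S), ← Finset.sum_coe_sort]
      intro i _ hi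
      have : (Z1 * H'ᵀ) i l = 0 := by simp [Matrix.mul_apply, Z1, hi]
      simp [this]
    have e2 : H * Z2 * H'ᵀ = ((H * Z2).submatrix id (fun s : T => s.1)) *
        (H'.submatrix id (fun s : T => s.1))ᵀ := by
      ext k l
      rw [Matrix.mul_apply, Matrix.mul_apply]
      simp only [Matrix.submatrix_apply, id, Matrix.transpose_apply]
      rw [← Finset.sum_subset (Finset.subset_univ T), ← Finset.sum_coe_sort]
      intro j _ hj
      have : (H * Z2) k j = 0 := by simp [Matrix.mul_apply, Z2, hj]
      simp [this]
    have e3 : (H * C) * (H' * Kᵀ)ᵀ = H * Y * H'ᵀ := by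
      rw [hY, Matrix.transpose_mul, Matrix.transpose_transpose]
      simp only [Matrix.mul_assoc]
    simp only [f, AddMonoidHom.prodMap, resMap, AddMonoidHom.prod_apply, AddMonoidHom.comp_apply,
      AddMonoidHom.mk'_apply, AddMonoidHom.coe_fst, AddMonoidHom.coe_snd]
    rw [e3, hdec, Matrix.mul_sub, Matrix.mul_sub, Matrix.sub_mul, Matrix.sub_mul, hZ, e1, e2]
    simp only [Matrix.mul_neg, Matrix.neg_mul]
    abel
  have hcount := ncard_preimage_mul f hf BadQ
  have hle := Set.ncard_le_ncard hsub (Set.toFinite _)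
  have hpos : 0 < Nat.card
    ((Matrix κ S F × Matrix κ (Fin r) F) × (Matrix κ T F × Matrix κ (Fin r) F)) := Nat.card_pos
  refine Nat.le_of_mul_le_mul_right ?_ hpos
  set w := Nat.card ((Matrix κ S F × Matrix κ (Fin r) F) × (Matrix κ T F × Matrix κ (Fin r) F))
  set v := Nat.card (Matrix κ ι F × Matrix κ ι F)
  set Q := Fintype.card F ^ (128 * h * r)
  calc _ ≤ (f ⁻¹' BadQ).ncard * Q * w := by gcongr
    _ = ((f ⁻¹' BadQ).ncard * w) * Q := by ring
    _ = (BadQ.ncard * Q) * v := by rw [hcount]; ring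
    _ ≤ (2 * w) * v := by gcongr
    _ = 2 * v * w := by ring

end countB
end QHP

namespace QHP

section union
variable {F : Type*} [Field F] [Fintype F]

/-- low weight vectors -/
abbrev Low (h : ℕ) (ι F : Type*) [Zero F] := {v : ι → F // {i | v i ≠ 0}.ncard ≤ h}

lemma card_low {ι : Type*} [Fintype ι] [DecidableEq ι] [DecidableEq F] {h : ℕ}
    (hι : Fintype.card ι = 8192 * h) :
    Nat.card (Low h ι F) ≤ (165888 * Fintype.card F) ^ h := by
  classical
  set q := Fintype.card F with hq
  have hq1 : 1 ≤ q := Fintype.card_pos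
  have hq0 : (0:ℝ) < q := by exact_mod_cast hq1
  set x : ℝ := 1 / (2048 * q) with hx
  have hx0 : 0 < x := by positivity
  have hx1 : x ≤ 1 := by
    rw [hx, div_le_one (by positivity)]
    have : (1:ℝ) ≤ q := by exact_mod_cast hq1
    linarith
  let f : F → ℝ := fun a => if a = 0 then 1 else x
  have hf0 : ∀ a, 0 ≤ f a := fun a => by
    simp only [f]; split_ifs <;> linarith
  have hsum : ∑ a, f a ≤ 1 + 1 / 2048 := by
    have : ∑ a, f a ≤ ∑ a : F, ((if a = 0 then 1 else 0) + x) := by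
      refine Finset.sum_le_sum fun a _ => ?_
      simp only [f]; split_ifs <;> linarith
    refine this.trans (le_of_eq ?_)
    rw [Finset.sum_add_distrib]
    simp only [Finset.sum_ite_eq', Finset.mem_univ, if_true, Finset.sum_const, Finset.card_univ,
      nsmul_eq_mul, ← hq, hx]
    field_simp
  have hprod : ∀ v : ι → F, ∏ i, f (v i) = x ^ ({i | v i ≠ 0}.ncard) := by
    intro v
    simp only [f]
    rw [Finset.prod_ite]
    simp only [Finset.prod_const_one, one_mul, Finset.prod_const]
    congr 1
    rw [← Set.ncard_coe_finset]
    congr 1; ext; simp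
  have hgen : ∑ v : ι → F, ∏ i, f (v i) ≤ 81 ^ h := by
    rw [← Fintype.prod_sum (fun (_ : ι) a => f a)]
    rw [Finset.prod_const, Finset.card_univ, hι]
    have h1 : (∑ a, f a) ≤ Real.exp (1 / 2048) := by
      have := Real.add_one_le_exp (1 / 2048 : ℝ)
      linarith
    calc (∑ a, f a) ^ (8192 * h) ≤ (Real.exp (1 / 2048)) ^ (8192 * h) := by
          apply pow_le_pow_left₀ (Finset.sum_nonneg fun a _ => hf0 a) h1
      _ = (Real.exp 1 ^ 4) ^ h := by
          rw [← Real.exp_nat_mul, ← Real.exp_nat_mul, ← Real.exp_nat_mul]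
          congr 1; push_cast; ring
      _ ≤ (3 ^ 4) ^ h := by
          have := Real.exp_one_lt_d9
          have : Real.exp 1 ≤ 3 := by linarith
          gcongr
      _ = _ := by norm_num
  have hlow : (Nat.card (Low h ι F) : ℝ) * x ^ h ≤ 81 ^ h := by
    refine le_trans ?_ hgen
    rw [Nat.card_eq_fintype_card, Fintype.card_subtype]
    rw [← nsmul_eq_mul, ← Finset.sum_const]
    refine (Finset.sum_le_sum (g := fun v : ι → F => ∏ i, f (v i)) ?_).trans ?_
    · intro v hv
      rw [hprod]
      exact pow_le_pow_of_le_one hx0.le hx1 (by simpa using hv)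
    · exact Finset.sum_le_sum_of_subset_of_nonneg (Finset.filter_subset _ _)
        fun v _ _ => Finset.prod_nonneg fun i _ => hf0 _
  have h2 : (Nat.card (Low h ι F) : ℝ) ≤ (165888 * q) ^ h := by
    have e : ((165888 : ℝ) * q) ^ h * x ^ h = 81 ^ h := by
      rw [← mul_pow, hx]; congr 1; field_simp; norm_num
    rw [← e] at hlow
    exact le_of_mul_le_mul_right hlow (by positivity)
  exact_mod_cast h2

lemma eq_of_agree {ι : Type*} [Fintype ι] [DecidableEq ι] {r : ℕ} (Y Y' : Matrix ι ι F)
    (I J : Fin r → ι)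
    (hI : ∀ i, Y i ∈ Submodule.span F (Set.range fun k => Y (I k)))
    (hJ : ∀ j, Y'ᵀ j ∈ Submodule.span F (Set.range fun k => Y'ᵀ (J k)))
    (hr : ∀ k, Y (I k) = Y' (I k)) (hc : ∀ k, Yᵀ (J k) = Y'ᵀ (J k)) : Y = Y' := by
  have hz : ∀ w : ι → F, (∀ k, Y (I k) ⬝ᵥ w = 0) → Y *ᵥ w = 0 := by
    intro w hw
    funext i
    have : ∀ y ∈ Submodule.span F (Set.range fun k => Y (I k)), y ⬝ᵥ w = 0 := by
      intro y hy
      induction hy using Submodule.span_induction with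
      | mem x hx => obtain ⟨k, rfl⟩ := hx; exact hw k
      | zero => simp
      | add x y _ _ hx hy => rw [add_dotProduct, hx, hy, add_zero]
      | smul a x _ hx => rw [smul_dotProduct, hx, smul_zero]
    exact this _ (hI i)
  suffices h : ∀ j, Yᵀ j = Y'ᵀ j by
    exact Matrix.transpose_injective (funext h)
  intro j
  -- the column of `Y'` is in the column space of `Y`
  have hcol : ∀ y ∈ Submodule.span F (Set.range fun k => Y'ᵀ (J k)), ∃ w, Y *ᵥ w = y := by
    intro y hy
    induction hy using Submodule.span_induction with
    | mem x hx =>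
      obtain ⟨k, rfl⟩ := hx
      refine ⟨Pi.single (J k) 1, ?_⟩
      change _ = Y'ᵀ (J k)
      rw [← hc k]
      ext i; simp
    | zero => exact ⟨0, by simp⟩
    | add x y _ _ hx hy =>
      obtain ⟨a, ha⟩ := hx
      obtain ⟨b, hb⟩ := hy
      exact ⟨a + b, by rw [mulVec_add, ha, hb]⟩
    | smul c x _ hx =>
      obtain ⟨a, ha⟩ := hx
      exact ⟨c • a, by rw [mulVec_smul, ha]⟩
  obtain ⟨w, hw⟩ := hcol _ (hJ j)
  have := hz (Pi.single j 1 - w) (by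
    intro k
    rw [dotProduct_sub]
    have : Y (I k) ⬝ᵥ w = Y' (I k) j := congrFun hw (I k)
    rw [this, ← hr k]; simp)
  rw [mulVec_sub, hw, sub_eq_zero] at this
  rw [← this]; ext i; simp

lemma exists_rows {ι : Type*} [Fintype ι] [DecidableEq ι] {r : ℕ} (Y : Matrix ι ι F)
    (hr : Y.rank = r) :
    ∃ I : Fin r → ι, ∀ i, Y i ∈ Submodule.span F (Set.range fun k => Y (I k)) := by
  rw [Matrix.rank_eq_finrank_span_row] at hr
  subst hr
  obtain ⟨f, hf, hs, _⟩ := Submodule.exists_fun_fin_finrank_span_eq F (Set.range Y.row)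
  choose I hI using hf
  refine ⟨I, fun i => ?_⟩
  have : (fun k => Y (I k)) = f := funext hI
  rw [this, hs]
  exact Submodule.subset_span ⟨i, rfl⟩

/-- rank `r` matrices with light rows and columns -/
abbrev LowMat (h r : ℕ) (ι F : Type*) [Field F] [Fintype ι] :=
  {Y : Matrix ι ι F // Y.rank = r ∧ (∀ i, {j | Y i j ≠ 0}.ncard ≤ h) ∧
    (∀ j, {i | Y i j ≠ 0}.ncard ≤ h)}

lemma card_lowMat {ι : Type*} [Fintype ι] [DecidableEq ι] {h r : ℕ} :
    Nat.card (LowMat h r ι F) ≤ (Fintype.card ι * Nat.card (Low h ι F)) ^ (2 * r) := by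
  classical
  have hI : ∀ Y : LowMat h r ι F, ∃ I : Fin r → ι,
      ∀ i, Y.1 i ∈ Submodule.span F (Set.range fun k => Y.1 (I k)) :=
    fun Y => exists_rows Y.1 Y.2.1
  have hJ : ∀ Y : LowMat h r ι F, ∃ I : Fin r → ι,
      ∀ i, Y.1ᵀ i ∈ Submodule.span F (Set.range fun k => Y.1ᵀ (I k)) :=
    fun Y => exists_rows Y.1ᵀ (by rw [Matrix.rank_transpose]; exact Y.2.1)
  choose I hI using hI
  choose J hJ using hJ
  let g : LowMat h r ι F → ((Fin r → ι) × (Fin r → Low h ι F)) × ((Fin r → ι) × (Fin r → Low h ι F)) :=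
    fun Y => ((I Y, fun k => ⟨Y.1 (I Y k), Y.2.2.1 _⟩), (J Y, fun k => ⟨Y.1ᵀ (J Y k), Y.2.2.2 _⟩))
  have hg : Function.Injective g := by
    intro Y Y' hYY
    simp only [g, Prod.mk.injEq] at hYY
    obtain ⟨⟨h1, h2⟩, h3, h4⟩ := hYY
    apply Subtype.ext
    refine eq_of_agree Y.1 Y'.1 (I Y) (J Y) (hI Y) (by rw [h3]; exact hJ Y') ?_ ?_
    · intro k
      have := congrArg Subtype.val (congrFun h2 k)
      simp only at this
      rw [this, h1]
    · intro k
      have := congrArg Subtype.val (congrFun h4 k)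
      simp only at this
      rw [this, h3]
  refine (Nat.card_le_card_of_injective g hg).trans (le_of_eq ?_)
  rw [Nat.card_prod, Nat.card_prod, Nat.card_fun, Nat.card_fun, Nat.card_fin,
    Nat.card_eq_fintype_card (α := ι)]
  ring

lemma numeric {h q N Λ : ℕ} (hh : 1 ≤ h) (hq : 2 ≤ q) (hN : N = 8192 * h)
    (hΛ : Λ ≤ (165888 * q) ^ h) : (N * Λ) ^ 2 * Λ ^ 2 * 64 ≤ q ^ (128 * h) := by
  have h1 : h ≤ 2 ^ h := Nat.lt_two_pow_self.le
  have hΛ' : Λ ≤ q ^ (19 * h) := by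
    calc Λ ≤ (165888 * q) ^ h := hΛ
      _ ≤ (q ^ 18 * q) ^ h := by
          gcongr
          calc 165888 ≤ 2 ^ 18 := by norm_num
            _ ≤ q ^ 18 := by gcongr
      _ = _ := by rw [← pow_succ, ← pow_mul]
  have hN' : N ≤ q ^ (14 * h) := by
    calc N ≤ 2 ^ 13 * 2 ^ h := by rw [hN]; gcongr; norm_num
      _ = 2 ^ (13 + h) := by rw [pow_add]
      _ ≤ 2 ^ (14 * h) := Nat.pow_le_pow_right (by norm_num) (by omega)
      _ ≤ _ := by gcongr
  have h64 : 64 ≤ q ^ (6 * h) := by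
    calc 64 = 2 ^ 6 := by norm_num
      _ ≤ 2 ^ (6 * h) := Nat.pow_le_pow_right (by norm_num) (by omega)
      _ ≤ _ := by gcongr
  calc (N * Λ) ^ 2 * Λ ^ 2 * 64
      ≤ (q ^ (14 * h) * q ^ (19 * h)) ^ 2 * (q ^ (19 * h)) ^ 2 * q ^ (6 * h) := by gcongr
    _ = q ^ (110 * h) := by rw [← pow_add, ← pow_mul, ← pow_mul, ← pow_add, ← pow_add]; congr 1; ring
    _ ≤ _ := Nat.pow_le_pow_right (by omega) (by omega)

/-- event for a given rank -/
def evt (h r : ℕ) (κ ι F : Type*) [Field F] [Fintype κ] [Fintype ι] :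
    Set (Matrix κ ι F × Matrix κ ι F) :=
  {x | ∃ (S T : Finset ι) (Y Z : Matrix ι ι F), S.card ≤ h ∧ T.card ≤ h ∧ Y.rank = r ∧
    (∀ i ∈ S, ∀ j, Y i j = 0) ∧ (∀ j ∈ T, ∀ i, Y i j = 0) ∧
    (∀ i, {j | Y i j ≠ 0}.ncard ≤ h) ∧ (∀ j, {i | Y i j ≠ 0}.ncard ≤ h) ∧
    x.1 * Z * x.2ᵀ = 0 ∧ ∀ i, i ∉ S → ∀ j, j ∉ T → Z i j = Y i j}

lemma evt_bound {κ ι : Type*} [Fintype κ] [Fintype ι] [DecidableEq κ]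
    [DecidableEq ι] [DecidableEq F] {h r : ℕ} (hκ : Fintype.card κ = 2048 * h)
    (hι : Fintype.card ι = 4 * Fintype.card κ) :
    (evt h r κ ι F).ncard * Fintype.card F ^ (128 * h * r) ≤
      (Nat.card (Low h ι F) ^ 2 * (Fintype.card ι * Nat.card (Low h ι F)) ^ (2 * r)) *
        (2 * Nat.card (Matrix κ ι F × Matrix κ ι F)) := by
  classical
  let A := Low h ι F × Low h ι F × LowMat h r ι F
  let sp : Low h ι F → Finset ι := fun v => Finset.univ.filter fun i => v.1 i ≠ 0
  have hsp : ∀ v, (sp v).card ≤ h := by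
    intro v
    have := v.2
    rw [← Set.ncard_coe_finset]
    simpa [sp] using this
  have hsp2 : ∀ S : Finset ι, S.card ≤ h → ∃ v, sp v = S := by
    intro S hS
    refine ⟨⟨fun i => if i ∈ S then 1 else 0, ?_⟩, ?_⟩
    · rw [← Set.ncard_coe_finset] at hS
      refine le_trans (le_of_eq ?_) hS
      congr 1; ext; simp
    · ext; simp [sp]
  let E : A → Set (Matrix κ ι F × Matrix κ ι F) := fun a =>
    {x | (∀ i ∈ sp a.1, ∀ j, a.2.2.1 i j = 0) ∧ (∀ j ∈ sp a.2.1, ∀ i, a.2.2.1 i j = 0) ∧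
      ∃ Z : Matrix ι ι F, x.1 * Z * x.2ᵀ = 0 ∧
      ∀ i, i ∉ sp a.1 → ∀ j, j ∉ sp a.2.1 → Z i j = a.2.2.1 i j}
  have hE : ∀ a, (E a).ncard * Fintype.card F ^ (128 * h * r) ≤
      2 * Nat.card (Matrix κ ι F × Matrix κ ι F) := by
    intro a
    by_cases h1 : (∀ i ∈ sp a.1, ∀ j, a.2.2.1 i j = 0) ∧ (∀ j ∈ sp a.2.1, ∀ i, a.2.2.1 i j = 0)
    · refine le_trans ?_ (event_bound hκ hι (sp a.1) (sp a.2.1) (hsp _) (hsp _) a.2.2.1 a.2.2.2.1 h1.1 h1.2)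
      gcongr
      · exact Set.toFinite _
      · rintro x ⟨_, _, hx⟩
        exact hx
    · have : E a = ∅ := by
        ext x
        simp only [Set.mem_empty_iff_false, iff_false]
        rintro ⟨h2, h3, _⟩
        exact h1 ⟨h2, h3⟩
      rw [this]; simp
  have hsub : evt h r κ ι F ⊆ ⋃ a, E a := by
    rintro x ⟨S, T, Y, Z, hS, hT, hr, hYS, hYT, hY1, hY2, hx, hZ⟩
    obtain ⟨v, rfl⟩ := hsp2 S hS
    obtain ⟨w, rfl⟩ := hsp2 T hT
    exact Set.mem_iUnion.2 ⟨(v, w, ⟨Y, hr, hY1, hY2⟩), hYS, hYT, Z, hx, hZ⟩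
  letI : Fintype A := Fintype.ofFinite A
  have h1 : (evt h r κ ι F).ncard ≤ ∑ a, (E a).ncard :=
    (Set.ncard_le_ncard hsub (Set.toFinite _)).trans (Set.ncard_iUnion_le_of_fintype E)
  calc _ ≤ (∑ a, (E a).ncard) * Fintype.card F ^ (128 * h * r) := by gcongr
    _ = ∑ a, (E a).ncard * Fintype.card F ^ (128 * h * r) := by rw [Finset.sum_mul]
    _ ≤ ∑ a : A, 2 * Nat.card (Matrix κ ι F × Matrix κ ι F) := Finset.sum_le_sum fun a _ => hE a
    _ = Nat.card A * (2 * Nat.card (Matrix κ ι F × Matrix κ ι F)) := by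
        simp [Nat.card_eq_fintype_card]
    _ ≤ _ := by
        gcongr
        simp only [A, Nat.card_prod]
        rw [← mul_assoc, ← pow_two]
        gcongr
        exact card_lowMat

lemma sum_geo (E : ℕ → ℕ) (T : ℕ) (hE : ∀ r, 1 ≤ r → E r * 64 ^ r ≤ 2 * T) (n : ℕ) :
    16 * ∑ r ∈ Finset.range n, E (r + 1) ≤ T := by
  have key : (16 : ℝ) * ∑ r ∈ Finset.range n, (E (r + 1) : ℝ) ≤ T * (1 - (1 / 64) ^ n) := by
    induction n with
    | zero => simp
    | succ n ih =>
      rw [Finset.sum_range_succ, mul_add]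
      have h1 : (E (n + 1) : ℝ) * 64 ^ (n + 1) ≤ 2 * T := by exact_mod_cast hE (n + 1) (by omega)
      have h2 : (E (n + 1) : ℝ) ≤ (T / 32) * (1 / 64) ^ n := by
        rw [one_div, inv_pow, ← div_eq_mul_inv, le_div_iff₀ (by positivity)]
        rw [pow_succ] at h1
        linarith
      have h3 : (0:ℝ) ≤ T * (1 / 64) ^ n := by positivity
      rw [pow_succ]
      linarith
  have h4 : (0:ℝ) ≤ T * (1 / 64) ^ n := by positivity
  have : (16 : ℝ) * ∑ r ∈ Finset.range n, (E (r + 1) : ℝ) ≤ T := by linarith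
  exact_mod_cast this

lemma not_unif_evt {κ ι : Type*} [Fintype κ] [Fintype ι] [DecidableEq ι] {h : ℕ}
    (H H' : Matrix κ ι F) (hU : ¬ Unif h H H') :
    ∃ r, r < Fintype.card ι ∧ (H, H') ∈ evt h (r + 1) κ ι F := by
  classical
  unfold Unif at hU
  push Not at hU
  obtain ⟨S, T, Z, hS, hT, h0, hr, hc, i, hi, j, hj, hZ⟩ := hU
  let Y : Matrix ι ι F := Matrix.of fun i j => if i ∉ S ∧ j ∉ T then Z i j else 0
  have hY0 : Y ≠ 0 := by
    intro h
    have := congrFun (congrFun h i) j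
    simp [Y, hi, hj] at this
    exact hZ this
  have hrk : Y.rank ≠ 0 := by
    intro h
    apply hY0
    have h1 := Submodule.finrank_eq_zero.1 h
    have h2 : Y.mulVecLin = 0 := LinearMap.range_eq_bot.1 h1
    ext a b
    have h3 := congrFun (LinearMap.congr_fun h2 (Pi.single b 1)) a
    simpa using h3
  have hle := Matrix.rank_le_card_width Y
  refine ⟨Y.rank - 1, by omega, S, T, Y, Z, hS, hT, by omega, ?_, ?_, ?_, ?_, h0, ?_⟩
  · intro i hi j; simp [Y, hi]
  · intro j hj i; simp [Y, hj]
  · intro i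
    by_cases hi : i ∈ S
    · simp [Y, hi]
    · refine le_trans (le_of_eq ?_) (hr i hi)
      congr 1; ext j; simp [Y, hi]
  · intro j
    by_cases hj : j ∈ T
    · simp [Y, hj]
    · refine le_trans (le_of_eq ?_) (hc j hj)
      congr 1; ext i; simp [Y, hj]
  · intro i hi j hj; simp [Y, hi, hj]

lemma unif_bound {κ ι : Type*} [Fintype κ] [Fintype ι] [DecidableEq κ]
    [DecidableEq ι] [DecidableEq F] {h : ℕ} (hh : 1 ≤ h) (hκ : Fintype.card κ = 2048 * h)
    (hι : Fintype.card ι = 4 * Fintype.card κ) :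
    16 * {x : Matrix κ ι F × Matrix κ ι F | ¬ Unif h x.1 x.2}.ncard ≤
      Nat.card (Matrix κ ι F × Matrix κ ι F) := by
  have hι' : Fintype.card ι = 8192 * h := by omega
  have hq : 2 ≤ Fintype.card F := Fintype.one_lt_card
  have hΛ := card_low (F := F) hι'
  have hΛ0 : 0 < Nat.card (Low h ι F) := by
    haveI : Nonempty (Low h ι F) := ⟨⟨0, by simp⟩⟩
    exact Nat.card_pos
  have hnum := numeric hh hq hι' hΛ
  set Λ := Nat.card (Low h ι F)
  have hE : ∀ r, 1 ≤ r → (evt h r κ ι F).ncard * 64 ^ r ≤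
      2 * Nat.card (Matrix κ ι F × Matrix κ ι F) := by
    intro r hr
    have hb := evt_bound (F := F) (r := r) hκ hι
    set B := Λ ^ 2 * (Fintype.card ι * Λ) ^ (2 * r) with hB
    have hB0 : 0 < B := by
      have : 0 < Fintype.card ι := by omega
      positivity
    have h1 : B * 64 ^ r ≤ Fintype.card F ^ (128 * h * r) := by
      calc B * 64 ^ r ≤ (Λ ^ 2) ^ r * (Fintype.card ι * Λ) ^ (2 * r) * 64 ^ r := by
            rw [hB]
            refine Nat.mul_le_mul_right _ (Nat.mul_le_mul_right _ ?_)
            exact Nat.le_self_pow (Nat.one_le_iff_ne_zero.1 hr) _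
        _ = ((Fintype.card ι * Λ) ^ 2 * Λ ^ 2 * 64) ^ r := by
            rw [mul_pow, mul_pow, ← pow_mul _ 2 r]; ring
        _ ≤ _ := by rw [pow_mul]; gcongr
    refine le_of_mul_le_mul_left ?_ hB0
    calc B * ((evt h r κ ι F).ncard * 64 ^ r) = (evt h r κ ι F).ncard * (B * 64 ^ r) := by ring
      _ ≤ (evt h r κ ι F).ncard * Fintype.card F ^ (128 * h * r) := by gcongr
      _ ≤ _ := hb
  refine le_trans ?_ (sum_geo (fun r => (evt h r κ ι F).ncard) _ hE (Fintype.card ι))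
  gcongr
  rw [Finset.sum_range]
  refine le_trans (Set.ncard_le_ncard ?_ (Set.toFinite _)) (Set.ncard_iUnion_le_of_fintype _)
  rintro ⟨H, H'⟩ hx
  obtain ⟨r, hr, hm⟩ := not_unif_evt H H' hx
  exact Set.mem_iUnion.2 ⟨⟨r, hr⟩, hm⟩

end union
end QHP

namespace QHP

section systematic
variable {F : Type*} [Field F] [Fintype F]

lemma prod_gl (q : ℕ) (hq : 3 ≤ q) (n : ℕ) :
    ((q : ℝ) ^ n + 1) * (q : ℝ) ^ (n * n) ≤
      2 * (q : ℝ) ^ n * ∏ i ∈ Finset.range n, ((q : ℝ) ^ n - (q : ℝ) ^ i) := by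
  have hq3 : (3 : ℝ) ≤ q := by exact_mod_cast hq
  induction n with
  | zero => simp; norm_num
  | succ n ih =>
    have e1 : ∏ i ∈ Finset.range (n + 1), ((q : ℝ) ^ (n + 1) - (q : ℝ) ^ i) =
        (∏ i ∈ Finset.range n, ((q : ℝ) ^ n - (q : ℝ) ^ i)) * (q : ℝ) ^ n * ((q : ℝ) ^ (n + 1) - 1) := by
      rw [Finset.prod_range_succ', pow_zero]
      congr 1
      have : ∀ i, (q : ℝ) ^ (n + 1) - (q : ℝ) ^ (i + 1) = ((q : ℝ) ^ n - (q : ℝ) ^ i) * q := by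
        intro i; ring
      simp only [this]
      rw [Finset.prod_mul_distrib]; simp
    rw [e1]
    set a := ∏ i ∈ Finset.range n, ((q : ℝ) ^ n - (q : ℝ) ^ i)
    set x := (q : ℝ) ^ n with hx
    have hx1 : 1 ≤ x := one_le_pow₀ (by linarith)
    have e2 : (q : ℝ) ^ ((n + 1) * (n + 1)) = (q : ℝ) ^ (n * n) * x * x * q := by
      rw [hx]; ring
    have e3 : (q : ℝ) ^ (n + 1) = x * q := by rw [hx]; ring
    rw [e2, e3]
    set b := (q : ℝ) ^ (n * n)
    have hb : 0 ≤ b := by positivity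
    have hpos : 0 ≤ x * (x * q - 1) * q := by
      have : 1 ≤ x * q := by nlinarith
      have : 0 ≤ x * q - 1 := by linarith
      positivity
    have h1 := mul_le_mul_of_nonneg_right ih hpos
    have h2 : (x * q + 1) * x ≤ (x + 1) * (x * q - 1) := by nlinarith
    have h3 := mul_le_mul_of_nonneg_right h2 (show 0 ≤ b * x * q by positivity)
    nlinarith

lemma card_gl {κ : Type*} [Fintype κ] [DecidableEq κ] (hq : 3 ≤ Fintype.card F) :
    Fintype.card F ^ (Fintype.card κ * Fintype.card κ) ≤ 2 * Nat.card (GL κ F) := by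
  set n := Fintype.card κ with hn
  set q := Fintype.card F with hqq
  have e : Nat.card (GL κ F) = Nat.card (GL (Fin n) F) :=
    Nat.card_congr (Units.mapEquiv
      (Matrix.reindexAlgEquiv F F (Fintype.equivFin κ)).toRingEquiv.toMulEquiv).toEquiv
  rw [e, Matrix.card_GL_field]
  have h := prod_gl q hq n
  have hc : ((∏ i : Fin n, (q ^ n - q ^ (i : ℕ)) : ℕ) : ℝ) =
      ∏ i ∈ Finset.range n, ((q : ℝ) ^ n - (q : ℝ) ^ i) := by
    rw [Finset.prod_range, Nat.cast_prod]
    refine Finset.prod_congr rfl fun i _ => ?_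
    rw [Nat.cast_sub (Nat.pow_le_pow_right (by omega) i.2.le)]
    push_cast; rfl
  rw [← hc] at h
  have hx : (0:ℝ) < (q : ℝ) ^ n := by
    have : (0:ℝ) < q := by exact_mod_cast (by omega : 0 < q)
    positivity
  have hb : (0:ℝ) ≤ (q : ℝ) ^ (n * n) := by positivity
  have : ((q : ℝ) ^ (n * n)) ≤ 2 * ((∏ i : Fin n, (q ^ n - q ^ (i : ℕ)) : ℕ) : ℝ) := by
    refine le_of_mul_le_mul_left ?_ hx
    nlinarith
  exact_mod_cast this

lemma unif_of_mul {κ ι : Type*} [Fintype κ] [Fintype ι] {h : ℕ} {H H' : Matrix κ ι F}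
    (g g' : Matrix κ κ F) (hU : Unif h (g * H) (g' * H')) : Unif h H H' := by
  intro S T Y hS hT h0 hr hc
  refine hU S T Y hS hT ?_ hr hc
  have : g * H * Y * (g' * H')ᵀ = g * (H * Y * H'ᵀ) * g'ᵀ := by
    simp only [Matrix.transpose_mul, Matrix.mul_assoc]
  rw [this, h0]; simp

/-- systematic matrix -/
def sys {κ ι τ : Type*} [DecidableEq κ] (e : ι ≃ κ ⊕ τ) (M : Matrix κ τ F) : Matrix κ ι F :=
  (fromCols (1 : Matrix κ κ F) M).submatrix id e

lemma sys_inv {κ ι τ : Type*} [Fintype κ] [Fintype ι] [Fintype τ] [DecidableEq κ]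
    (e : ι ≃ κ ⊕ τ) (M : Matrix κ τ F) : ∃ R : Matrix ι κ F, sys e M * R = 1 := by
  refine ⟨(fromRows (1 : Matrix κ κ F) 0).submatrix e id, ?_⟩
  rw [sys, Matrix.submatrix_mul_equiv, fromCols_mul_fromRows]
  simp

lemma mul_sys {κ ι τ : Type*} [Fintype κ] [DecidableEq κ]
    (e : ι ≃ κ ⊕ τ) (M : Matrix κ τ F) (g : Matrix κ κ F) :
    g * sys e M = (fromCols g (g * M)).submatrix id e := by
  ext i j
  simp only [sys, Matrix.mul_apply, submatrix_apply, id]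
  rcases e j with k | t
  · simp [Matrix.one_apply]
  · simp [Matrix.mul_apply]

lemma mul_sys_inj {κ ι τ : Type*} [Fintype κ] [DecidableEq κ]
    (e : ι ≃ κ ⊕ τ) {M M' : Matrix κ τ F} {g g' : GL κ F}
    (hg : g.1 * sys e M = g'.1 * sys e M') : g = g' ∧ M = M' := by
  rw [mul_sys, mul_sys] at hg
  have h1 : fromCols g.1 (g.1 * M) = fromCols g'.1 (g'.1 * M') := by
    ext i j
    have := congrFun (congrFun hg i) (e.symm j)
    simpa using this
  obtain ⟨h2, h3⟩ := fromCols_inj h1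
  have h4 : g = g' := Units.ext h2
  subst h4
  refine ⟨rfl, ?_⟩
  have := congrArg (fun A => (g⁻¹).1 * A) h3
  simp only [← Matrix.mul_assoc] at this
  have hi : (g⁻¹).1 * g.1 = 1 := by rw [← Units.val_mul]; simp
  rw [hi, Matrix.one_mul, Matrix.one_mul] at this
  exact this

lemma sys_bound {κ ι τ : Type*} [Fintype κ] [Fintype ι] [Fintype τ] [DecidableEq κ]
    [DecidableEq ι] [DecidableEq F] {h : ℕ} (hh : 1 ≤ h) (hq : 3 ≤ Fintype.card F)
    (hκ : Fintype.card κ = 2048 * h)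
    (hι : Fintype.card ι = 4 * Fintype.card κ) (e : ι ≃ κ ⊕ τ) :
    4 * {x : Matrix κ τ F × Matrix κ τ F | ¬ Unif h (sys e x.1) (sys e x.2)}.ncard ≤
      Nat.card (Matrix κ τ F × Matrix κ τ F) := by
  have hb := unif_bound (F := F) hh hκ hι
  have hgl := card_gl (F := F) (κ := κ) hq
  set badM := {x : Matrix κ τ F × Matrix κ τ F | ¬ Unif h (sys e x.1) (sys e x.2)} with hbadM
  set bad := {x : Matrix κ ι F × Matrix κ ι F | ¬ Unif h x.1 x.2} with hbad
  set L := Nat.card (GL κ F)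
  have hinj : L * L * badM.ncard ≤ bad.ncard := by
    let f : (GL κ F × GL κ F) × badM → bad := fun p =>
      ⟨(p.1.1.1 * sys e p.2.1.1, p.1.2.1 * sys e p.2.1.2), fun hU => p.2.2 (unif_of_mul _ _ hU)⟩
    have hf : Function.Injective f := by
      rintro ⟨⟨g, g'⟩, ⟨⟨M, M'⟩, hM⟩⟩ ⟨⟨k, k'⟩, ⟨⟨N, N'⟩, hN⟩⟩ hfe
      simp only [f, Subtype.mk.injEq, Prod.mk.injEq] at hfe
      obtain ⟨rfl, rfl⟩ := mul_sys_inj e hfe.1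
      obtain ⟨rfl, rfl⟩ := mul_sys_inj e hfe.2
      rfl
    have := Nat.card_le_card_of_injective f hf
    rw [Nat.card_prod, Nat.card_prod, Nat.card_coe_set_eq, Nat.card_coe_set_eq] at this
    exact this
  set m := Fintype.card κ
  set q := Fintype.card F
  have hτ : Fintype.card τ = 3 * m := by
    have := Fintype.card_congr e
    rw [Fintype.card_sum] at this; omega
  have hA : Nat.card (Matrix κ ι F × Matrix κ ι F) =
      q ^ (m * m) * q ^ (m * m) * Nat.card (Matrix κ τ F × Matrix κ τ F) := by
    rw [Nat.card_prod, Nat.card_prod, card_mat, card_mat, hι, hτ]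
    simp only [← pow_add]
    congr 1
    ring
  have hp : 0 < q ^ (m * m) * q ^ (m * m) := by
    have : 0 < q := by omega
    positivity
  refine le_of_mul_le_mul_left ?_ hp
  rw [← hA]
  calc q ^ (m * m) * q ^ (m * m) * (4 * badM.ncard)
      ≤ (2 * L) * (2 * L) * (4 * badM.ncard) := by gcongr
    _ = 16 * (L * L * badM.ncard) := by ring
    _ ≤ 16 * bad.ncard := by gcongr
    _ ≤ _ := hb

/-- swap of the outer blocks -/
def eswap (κ σ : Type*) : κ ⊕ (σ ⊕ κ) ≃ κ ⊕ (σ ⊕ κ) where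
  toFun := Sum.elim (fun k => Sum.inr (Sum.inr k))
    (Sum.elim (fun s => Sum.inr (Sum.inl s)) (fun k => Sum.inl k))
  invFun := Sum.elim (fun k => Sum.inr (Sum.inr k))
    (Sum.elim (fun s => Sum.inr (Sum.inl s)) (fun k => Sum.inl k))
  left_inv := by rintro (k | s | k) <;> rfl
  right_inv := by rintro (k | s | k) <;> rfl

lemma sys_orth {κ σ : Type*} [Fintype κ] [Fintype σ] [DecidableEq κ]
    (P V : Matrix κ σ F) (Q : Matrix κ κ F) :
    sys (Equiv.refl (κ ⊕ (σ ⊕ κ))) (fromCols P Q) *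
      (sys (eswap κ σ) (fromCols V (-(V * Pᵀ + Qᵀ))))ᵀ = 0 := by
  have h1 : sys (Equiv.refl (κ ⊕ (σ ⊕ κ))) (fromCols P Q) = fromCols 1 (fromCols P Q) := rfl
  have h2 : sys (eswap κ σ) (fromCols V (-(V * Pᵀ + Qᵀ))) =
      fromCols (-(V * Pᵀ + Qᵀ)) (fromCols V 1) := by
    ext i j
    rcases j with k | s | k <;> simp [sys, eswap]
  rw [h1, h2, transpose_fromCols, transpose_fromCols, fromCols_mul_fromRows, fromCols_mul_fromRows]
  simp

theorem exists_good {κ : Type*} [Fintype κ] [DecidableEq κ] {h : ℕ} (hh : 1 ≤ h)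
    (hq : 3 ≤ Fintype.card F) (hκ : Fintype.card κ = 2048 * h) :
    ∃ H H' G G' : Matrix κ (κ ⊕ ((κ ⊕ κ) ⊕ κ)) F, Unif h H H' ∧ Unif h G G' ∧
      H * Gᵀ = 0 ∧ H' * G'ᵀ = 0 ∧ (∃ R : Matrix (κ ⊕ ((κ ⊕ κ) ⊕ κ)) κ F, H * R = 1) ∧
      (∃ R : Matrix (κ ⊕ ((κ ⊕ κ) ⊕ κ)) κ F, H' * R = 1) ∧
      (∃ R : Matrix (κ ⊕ ((κ ⊕ κ) ⊕ κ)) κ F, G * R = 1) ∧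
      (∃ R : Matrix (κ ⊕ ((κ ⊕ κ) ⊕ κ)) κ F, G' * R = 1) := by
  classical
  let A := Matrix κ (κ ⊕ κ) F
  let B := Matrix κ κ F
  let Mt := Matrix κ ((κ ⊕ κ) ⊕ κ) F
  let Ω := (A × B × A) × (A × B × A)
  let U : A × B × A → B := fun x => -(x.2.2 * x.1ᵀ + x.2.1ᵀ)
  let e1 : κ ⊕ ((κ ⊕ κ) ⊕ κ) ≃ κ ⊕ ((κ ⊕ κ) ⊕ κ) := Equiv.refl _
  let e2 := eswap κ (κ ⊕ κ)
  have hι : Fintype.card (κ ⊕ ((κ ⊕ κ) ⊕ κ)) = 4 * Fintype.card κ := by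
    simp only [Fintype.card_sum]; ring
  let bad1 : Set (Mt × Mt) := {x | ¬ Unif h (sys e1 x.1) (sys e1 x.2)}
  let bad2 : Set (Mt × Mt) := {x | ¬ Unif h (sys e2 x.1) (sys e2 x.2)}
  have hb1 : 4 * bad1.ncard ≤ Nat.card (Mt × Mt) := sys_bound hh hq hκ hι e1
  have hb2 : 4 * bad2.ncard ≤ Nat.card (Mt × Mt) := sys_bound hh hq hκ hι e2
  let f1 : Ω →+ Mt × Mt := AddMonoidHom.mk'
    (fun x => (fromCols x.1.1 x.1.2.1, fromCols x.2.1 x.2.2.1)) (by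
      intro x y
      refine Prod.ext ?_ ?_ <;>
      · ext i j
        rcases j with j | j <;> rfl)
  have hf1 : Function.Surjective f1 := by
    rintro ⟨M, M'⟩
    refine ⟨((M.toCols₁, M.toCols₂, 0), (M'.toCols₁, M'.toCols₂, 0)), ?_⟩
    exact Prod.ext (fromCols_toCols M) (fromCols_toCols M')
  let f2 : Ω →+ Mt × Mt := AddMonoidHom.mk'
    (fun x => (fromCols x.1.2.2 x.1.2.1, fromCols x.2.2.2 x.2.2.1)) (by
      intro x y
      refine Prod.ext ?_ ?_ <;>
      · ext i j
        rcases j with j | j <;> rfl)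
  have hf2 : Function.Surjective f2 := by
    rintro ⟨M, M'⟩
    refine ⟨((0, M.toCols₂, M.toCols₁), (0, M'.toCols₂, M'.toCols₁)), ?_⟩
    exact Prod.ext (fromCols_toCols M) (fromCols_toCols M')
  let φ : Ω → Ω := fun x => ((x.1.1, U x.1, x.1.2.2), (x.2.1, U x.2, x.2.2.2))
  have hφ : Function.Injective φ := by
    rintro ⟨⟨P, Q, V⟩, ⟨P', Q', V'⟩⟩ ⟨⟨P1, Q1, V1⟩, ⟨P1', Q1', V1'⟩⟩ hxy
    have a1 : P = P1 := congrArg (fun x : Ω => x.1.1) hxy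
    have a2 : V = V1 := congrArg (fun x : Ω => x.1.2.2) hxy
    have a3 : P' = P1' := congrArg (fun x : Ω => x.2.1) hxy
    have a4 : V' = V1' := congrArg (fun x : Ω => x.2.2.2) hxy
    subst a1 a2 a3 a4
    have h2 : -(V * Pᵀ + Qᵀ) = -(V * Pᵀ + Q1ᵀ) := congrArg (fun x : Ω => x.1.2.1) hxy
    have h3 : -(V' * P'ᵀ + Q'ᵀ) = -(V' * P'ᵀ + Q1'ᵀ) := congrArg (fun x : Ω => x.2.2.1) hxy
    have h2 := Matrix.transpose_injective (add_left_cancel (neg_injective h2))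
    have h3 := Matrix.transpose_injective (add_left_cancel (neg_injective h3))
    rw [h2, h3]
  have hpre : ∀ (f : Ω →+ Mt × Mt) (hf : Function.Surjective f) (b : Set (Mt × Mt)),
      4 * b.ncard ≤ Nat.card (Mt × Mt) → 4 * (f ⁻¹' b).ncard ≤ Nat.card Ω := by
    intro f hf b hb
    have := ncard_preimage_mul f hf b
    have hpos : 0 < Nat.card (Mt × Mt) := Nat.card_pos
    refine le_of_mul_le_mul_right ?_ hpos
    rw [mul_assoc, this]
    calc 4 * (b.ncard * Nat.card Ω) = (4 * b.ncard) * Nat.card Ω := by ring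
      _ ≤ Nat.card (Mt × Mt) * Nat.card Ω := by gcongr
      _ = _ := mul_comm _ _
  have hB1 := hpre f1 hf1 bad1 hb1
  have hB2 : 4 * (φ ⁻¹' (f2 ⁻¹' bad2)).ncard ≤ Nat.card Ω := by
    refine le_trans ?_ (hpre f2 hf2 bad2 hb2)
    refine Nat.mul_le_mul_left _ ?_
    rw [← Set.ncard_image_of_injective _ hφ]
    exact Set.ncard_le_ncard (Set.image_preimage_subset _ _) (Set.toFinite _)
  have hex : ∃ x : Ω, x ∉ f1 ⁻¹' bad1 ∧ x ∉ φ ⁻¹' (f2 ⁻¹' bad2) := by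
    by_contra hcon
    push Not at hcon
    have hsub : (Set.univ : Set Ω) ⊆ f1 ⁻¹' bad1 ∪ φ ⁻¹' (f2 ⁻¹' bad2) := by
      intro x _
      by_cases hx : x ∈ f1 ⁻¹' bad1
      · exact Or.inl hx
      · exact Or.inr (hcon x hx)
    have h1 := (Set.ncard_le_ncard hsub (Set.toFinite _)).trans (Set.ncard_union_le _ _)
    rw [Set.ncard_univ] at h1
    have hpos : 0 < Nat.card Ω := Nat.card_pos
    omega
  obtain ⟨x, hx1, hx2⟩ := hex
  refine ⟨sys e1 (fromCols x.1.1 x.1.2.1), sys e1 (fromCols x.2.1 x.2.2.1),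
    sys e2 (fromCols x.1.2.2 (U x.1)), sys e2 (fromCols x.2.2.2 (U x.2)),
    not_not.1 hx1, not_not.1 hx2, sys_orth _ _ _, sys_orth _ _ _,
    sys_inv _ _, sys_inv _ _, sys_inv _ _, sys_inv _ _⟩

end systematic
end QHP
namespace QHP

section assembly
variable {F : Type*} [Field F] {κ ι π : Type*}

/-- qudit labels -/
abbrev Qd (κ ι π : Type*) := (ι × ι) ⊕ ((κ × κ) ⊕ ((κ × κ) ⊕ π))
/-- check labels -/
abbrev Rw (κ ι π : Type*) := (ι × κ) ⊕ ((κ × ι) ⊕ π)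

/-- assemble a vector out of its blocks -/
def pack (Y : Matrix ι ι F) (X W : Matrix κ κ F) (z : π → F) : Qd κ ι π → F :=
  Sum.elim (fun p => Y p.1 p.2) (Sum.elim (fun p => X p.1 p.2) (Sum.elim (fun p => W p.1 p.2) z))

/-- the check matrix -/
def K [DecidableEq κ] [DecidableEq ι] [DecidableEq π] (H H' G G' : Matrix κ ι F) (ε : F) :
    Matrix (Rw κ ι π) (Qd κ ι π) F :=
  Matrix.of <| Sum.elim
    (fun r => Sum.elim (fun p => if p.1 = r.1 then H' r.2 p.2 else 0)
      (Sum.elim (fun p => if p.2 = r.2 then G p.1 r.1 else 0) 0))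
    (Sum.elim
      (fun r => Sum.elim (fun p => if p.2 = r.2 then H r.1 p.1 else 0)
        (Sum.elim 0 (Sum.elim (fun p => if p.1 = r.1 then G' p.2 r.2 else 0) 0)))
      (fun k => Sum.elim 0 (Sum.elim 0 (Sum.elim 0 (fun l => if l = k then ε else 0)))))

variable [Fintype κ] [Fintype ι] [Fintype π] [DecidableEq κ] [DecidableEq ι] [DecidableEq π]

lemma K_mulVec (H H' G G' : Matrix κ ι F) (ε : F) (Y : Matrix ι ι F) (X W : Matrix κ κ F)
    (z : π → F) :
    K H H' G G' ε *ᵥ pack Y X W z = Sum.elim (fun r => (Y * H'ᵀ + Gᵀ * X) r.1 r.2)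
      (Sum.elim (fun r => (H * Y + W * G') r.1 r.2) (fun k => ε * z k)) := by
  funext r
  rcases r with ⟨i, b⟩ | ⟨a, j⟩ | k
  · simp only [K, pack, mulVec, dotProduct, Fintype.sum_sum_type, Fintype.sum_prod_type, of_apply,
      Sum.elim_inl, Sum.elim_inr, Pi.zero_apply, zero_mul, Finset.sum_const_zero, add_zero,
      ite_mul, Matrix.add_apply, Matrix.mul_apply, transpose_apply]
    congr 1
    · rw [Finset.sum_comm]
      simp [mul_comm]
    · simp
  · simp only [K, pack, mulVec, dotProduct, Fintype.sum_sum_type, Fintype.sum_prod_type, of_apply,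
      Sum.elim_inl, Sum.elim_inr, Pi.zero_apply, zero_mul, Finset.sum_const_zero, add_zero, zero_add,
      ite_mul, Matrix.add_apply, Matrix.mul_apply, transpose_apply]
    congr 1
    · simp
    · rw [Finset.sum_comm]
      simp [mul_comm]
  · simp [K, pack, mulVec, dotProduct]

lemma K_vecMul (H H' G G' : Matrix κ ι F) (ε : F) (Q : Matrix ι κ F) (P : Matrix κ ι F)
    (z : π → F) :
    (Sum.elim (fun r => Q r.1 r.2) (Sum.elim (fun r => P r.1 r.2) z)) ᵥ* K H H' G G' ε =
      pack (Q * H' + Hᵀ * P) (G * Q) (P * G'ᵀ) (fun k => ε * z k) := by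
  funext r
  rcases r with ⟨i, b⟩ | ⟨a, j⟩ | ⟨a, j⟩ | k
  · simp only [K, pack, vecMul, dotProduct, Fintype.sum_sum_type, Fintype.sum_prod_type, of_apply,
      Sum.elim_inl, Sum.elim_inr, Pi.zero_apply, mul_zero, Finset.sum_const_zero, add_zero,
      mul_ite, Matrix.add_apply, Matrix.mul_apply, transpose_apply]
    congr 1
    · rw [Finset.sum_comm]; simp
    · simp [mul_comm]
  · simp only [K, pack, vecMul, dotProduct, Fintype.sum_sum_type, Fintype.sum_prod_type, of_apply,
      Sum.elim_inl, Sum.elim_inr, Pi.zero_apply, mul_zero, Finset.sum_const_zero, add_zero,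
      mul_ite, Matrix.mul_apply]
    simp [mul_comm]
  · simp only [K, pack, vecMul, dotProduct, Fintype.sum_sum_type, Fintype.sum_prod_type, of_apply,
      Sum.elim_inl, Sum.elim_inr, Pi.zero_apply, mul_zero, Finset.sum_const_zero, add_zero, zero_add,
      mul_ite, Matrix.mul_apply, transpose_apply]
    rw [Finset.sum_comm]; simp
  · simp [K, pack, vecMul, dotProduct, mul_comm]

lemma exists_pack (v : Qd κ ι π → F) : ∃ Y X W z, v = pack Y X W z :=
  ⟨Matrix.of fun i j => v (Sum.inl (i, j)), Matrix.of fun i j => v (Sum.inr (Sum.inl (i, j))),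
    Matrix.of fun i j => v (Sum.inr (Sum.inr (Sum.inl (i, j)))),
    fun k => v (Sum.inr (Sum.inr (Sum.inr k))), by
      funext r
      rcases r with r | r | r | k <;> rfl⟩

lemma K_weight [DecidableEq F] [Nonempty κ] (H H' G G' : Matrix κ ι F) (ε : F) (r : Rw κ ι π) :
    (Finset.univ.filter fun c => K H H' G G' ε r c ≠ 0).card ≤ Fintype.card ι + Fintype.card κ := by
  rcases r with ⟨i, b⟩ | ⟨a, j⟩ | k
  · let f : ι ⊕ κ → Qd κ ι π := Sum.elim (fun j => Sum.inl (i, j)) (fun a => Sum.inr (Sum.inl (a, b)))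
    have : (Finset.univ.filter fun c => K H H' G G' ε (Sum.inl (i, b)) c ≠ 0) ⊆
        Finset.univ.image f := by
      intro c hc
      rw [Finset.mem_filter] at hc
      rcases c with ⟨i', j⟩ | ⟨a, b'⟩ | ⟨a, b'⟩ | k
      · have h1 : i' = i := by by_contra h; simp [K, h] at hc
        subst h1
        exact Finset.mem_image.2 ⟨Sum.inl j, Finset.mem_univ _, rfl⟩
      · have h1 : b' = b := by by_contra h; simp [K, h] at hc
        subst h1
        exact Finset.mem_image.2 ⟨Sum.inr a, Finset.mem_univ _, rfl⟩
      · simp [K] at hc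
      · simp [K] at hc
    refine (Finset.card_le_card this).trans (Finset.card_image_le.trans ?_)
    simp
  · let f : ι ⊕ κ → Qd κ ι π :=
      Sum.elim (fun i => Sum.inl (i, j)) (fun b => Sum.inr (Sum.inr (Sum.inl (a, b))))
    have : (Finset.univ.filter fun c => K H H' G G' ε (Sum.inr (Sum.inl (a, j))) c ≠ 0) ⊆
        Finset.univ.image f := by
      intro c hc
      rw [Finset.mem_filter] at hc
      rcases c with ⟨i, j'⟩ | ⟨a', b⟩ | ⟨a', b⟩ | k
      · have h1 : j' = j := by by_contra h; simp [K, h] at hc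
        subst h1
        exact Finset.mem_image.2 ⟨Sum.inl i, Finset.mem_univ _, rfl⟩
      · simp [K] at hc
      · have h1 : a' = a := by by_contra h; simp [K, h] at hc
        subst h1
        exact Finset.mem_image.2 ⟨Sum.inr b, Finset.mem_univ _, rfl⟩
      · simp [K] at hc
    refine (Finset.card_le_card this).trans (Finset.card_image_le.trans ?_)
    simp
  · have : (Finset.univ.filter fun c => K H H' G G' ε (Sum.inr (Sum.inr k)) c ≠ 0) ⊆
        {Sum.inr (Sum.inr (Sum.inr k))} := by
      intro c hc
      rw [Finset.mem_filter] at hc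
      rcases c with c | c | c | l
      · simp [K] at hc
      · simp [K] at hc
      · simp [K] at hc
      · have h1 : l = k := by by_contra h; simp [K, h] at hc
        subst h1; simp
    refine (Finset.card_le_card this).trans ?_
    have : 0 < Fintype.card κ := Fintype.card_pos
    rw [Finset.card_singleton]; omega

lemma K_rank_one (H H' G G' : Matrix κ ι F) (ε : F) :
    (K (π := π) H H' G G' ε).rank ≤ 2 * (Fintype.card ι * Fintype.card κ) + Fintype.card π := by
  refine (Matrix.rank_le_card_height _).trans (le_of_eq ?_)
  simp only [Fintype.card_sum, Fintype.card_prod]; ring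

lemma K_rank_zero (H H' G G' : Matrix κ ι F) :
    (K (π := π) H H' G G' 0).rank ≤ 2 * (Fintype.card ι * Fintype.card κ) := by
  rw [Matrix.rank_eq_finrank_span_row]
  let g : (ι × κ) ⊕ (κ × ι) → (Qd κ ι π → F) := fun r =>
    K H H' G G' 0 (Sum.elim Sum.inl (fun s => Sum.inr (Sum.inl s)) r)
  have hle : Submodule.span F (Set.range (K (π := π) H H' G G' 0).row) ≤
      Submodule.span F (Set.range g) := by
    rw [Submodule.span_le]
    rintro _ ⟨r, rfl⟩
    rcases r with r | r | k
    · exact Submodule.subset_span ⟨Sum.inl r, rfl⟩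
    · exact Submodule.subset_span ⟨Sum.inr r, rfl⟩
    · have : (K (π := π) H H' G G' 0).row (Sum.inr (Sum.inr k)) = 0 := by
        funext c
        rcases c with c | c | c | l <;> simp [K, Matrix.row]
      rw [this]; exact Submodule.zero_mem _
  refine (Submodule.finrank_mono hle).trans ((finrank_range_le_card g).trans (le_of_eq ?_))
  simp only [Fintype.card_sum, Fintype.card_prod]; ring

/-- swap of the two small blocks -/
def sw (κ ι π : Type*) : Qd κ ι π ≃ Qd κ ι π where
  toFun := Sum.elim Sum.inl (Sum.elim (fun p => Sum.inr (Sum.inr (Sum.inl p)))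
    (Sum.elim (fun p => Sum.inr (Sum.inl p)) (fun k => Sum.inr (Sum.inr (Sum.inr k)))))
  invFun := Sum.elim Sum.inl (Sum.elim (fun p => Sum.inr (Sum.inr (Sum.inl p)))
    (Sum.elim (fun p => Sum.inr (Sum.inl p)) (fun k => Sum.inr (Sum.inr (Sum.inr k)))))
  left_inv := by rintro (k | k | k | k) <;> rfl
  right_inv := by rintro (k | k | k | k) <;> rfl

lemma pack_sw (Y : Matrix ι ι F) (X W : Matrix κ κ F) (z : π → F) :
    pack Y X W z ∘ sw κ ι π = pack Y W X z := by
  funext r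
  rcases r with r | r | r | k <;> rfl

lemma K_ker (H H' G G' : Matrix κ ι F) (ε : F) [Nonempty ι] {h : ℕ} (hh : 1 ≤ h)
    (hU : Unif h H H') (hHG : H * Gᵀ = 0) (hHG' : H' * G'ᵀ = 0)
    {R R' : Matrix ι κ F} (hR : G * R = 1) (hR' : G' * R' = 1)
    (v : Qd κ ι π → F) (hv : K H H' G G' ε *ᵥ v = 0) (hw : {c | v c ≠ 0}.ncard ≤ h ^ 2) :
    ∃ (P : Matrix κ ι F) (Q : Matrix ι κ F) (z : π → F), (∀ k, ε * z k = 0) ∧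
      v = pack (Gᵀ * P + Q * G') (-(P * H'ᵀ)) (-(H * Q)) z := by
  obtain ⟨Y, X, W, z, rfl⟩ := exists_pack v
  rw [K_mulVec] at hv
  have h1 : Y * H'ᵀ + Gᵀ * X = 0 := by
    ext i b
    exact congrFun hv (Sum.inl (i, b))
  have h2 : H * Y + W * G' = 0 := by
    ext a j
    exact congrFun hv (Sum.inr (Sum.inl (a, j)))
  have h3 : ∀ k, ε * z k = 0 := fun k => congrFun hv (Sum.inr (Sum.inr k))
  obtain ⟨P, Q, rfl, rfl, rfl⟩ := det_main hh hU hHG hHG' hR hR' Y X W h1 h2 (by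
    refine le_trans ?_ hw
    rw [← Set.ncard_image_of_injective {p : ι × ι | Y p.1 p.2 ≠ 0}
      (Sum.inl_injective (β := (κ × κ) ⊕ ((κ × κ) ⊕ π)))]
    refine Set.ncard_le_ncard ?_ (Set.toFinite _)
    rintro _ ⟨p, hp, rfl⟩
    exact hp)
  exact ⟨P, Q, z, h3, rfl⟩

lemma K_orth (H H' G G' : Matrix κ ι F) (ε : F) (hHG : H * Gᵀ = 0) (hHG' : H' * G'ᵀ = 0) :
    K (π := π) H H' G G' ε * ((K (π := π) G G' (-H) (-H') 0).submatrix id (sw κ ι π))ᵀ = 0 := by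
  have hGH : G' * H'ᵀ = 0 := by
    have := congrArg Matrix.transpose hHG'
    simpa using this
  ext r s
  have key : ∀ u : Rw κ ι π → F,
      K (π := π) H H' G G' ε *ᵥ ((u ᵥ* K (π := π) G G' (-H) (-H') 0) ∘ sw κ ι π) = 0 := by
    intro u
    have hu : u = Sum.elim (fun r => (Matrix.of fun i b => u (Sum.inl (i, b))) r.1 r.2)
        (Sum.elim (fun r => (Matrix.of fun a j => u (Sum.inr (Sum.inl (a, j)))) r.1 r.2)
          (fun k => u (Sum.inr (Sum.inr k)))) := by
      funext r
      rcases r with r | r | k <;> rfl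
    rw [hu]
    generalize (Matrix.of fun i b => u (Sum.inl (i, b))) = Q
    generalize (Matrix.of fun a j => u (Sum.inr (Sum.inl (a, j)))) = P
    rw [K_vecMul, pack_sw, K_mulVec]
    have e1 : (Q * G' + Gᵀ * P) * H'ᵀ + Gᵀ * (P * (-H')ᵀ) = 0 := by
      rw [Matrix.add_mul, Matrix.mul_assoc, hGH, Matrix.mul_assoc]
      simp
    have e2 : H * (Q * G' + Gᵀ * P) + (-H * Q) * G' = 0 := by
      rw [Matrix.mul_add, ← Matrix.mul_assoc H Gᵀ, hHG]
      simp [Matrix.mul_assoc]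
    rw [e1, e2]
    funext r
    rcases r with r | r | k <;> simp
  have := congrFun (key (Pi.single s 1)) r
  rw [Matrix.single_one_vecMul] at this
  exact this

lemma mem_span_reindex {R C : Type*} [Fintype R] [Fintype C] {s N : ℕ} (M : Matrix R C F)
    (eR : Fin s ≃ R) (eC : Fin N ≃ C) (u : R → F) :
    (u ᵥ* M) ∘ eC ∈ Submodule.span F (Set.range fun i => (M.submatrix eR eC) i) := by
  have h1 : (u ᵥ* M) ∘ eC = ∑ i, u (eR i) • (M.submatrix eR eC) i := by
    funext c
    simp only [Function.comp, vecMul, dotProduct, Finset.sum_apply, Pi.smul_apply, smul_eq_mul,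
      submatrix_apply]
    exact (Equiv.sum_comp eR (fun r => u r * M r (eC c))).symm
  rw [h1]
  exact Submodule.sum_mem _ fun i _ => Submodule.smul_mem _ _ (Submodule.subset_span ⟨i, rfl⟩)

lemma reindex_mulVec {R C : Type*} [Fintype R] [Fintype C] {s N : ℕ} (M : Matrix R C F)
    (eR : Fin s ≃ R) (eC : Fin N ≃ C) (v : Fin N → F) (hv : (M.submatrix eR eC) *ᵥ v = 0) :
    M *ᵥ (v ∘ eC.symm) = 0 := by
  funext r
  have h1 := congrFun hv (eR.symm r)
  simp only [mulVec, dotProduct, submatrix_apply, Equiv.apply_symm_apply, Pi.zero_apply] at h1 ⊢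
  rw [← h1, ← Equiv.sum_comp eC]
  simp

lemma card_filter_equiv {A B : Type*} [Fintype A] [Fintype B] (e : A ≃ B) (p : B → Prop)
    [DecidablePred p] : (Finset.univ.filter fun a => p (e a)).card = (Finset.univ.filter p).card := by
  refine Finset.card_bij (fun a _ => e a) ?_ ?_ ?_
  · intro a ha; simpa using ha
  · intro a _ b _ h; exact e.injective h
  · intro b hb; exact ⟨e.symm b, by simpa using hb, by simp⟩

end assembly

theorem main {D : ℕ} [Fact D.Prime] (hDodd : Odd D) (n : ℕ) (hn : 6144 ≤ n) :
      ∃ (s : ℕ) (HX HZ : Matrix (Fin s) (Fin (2 * n ^ 2)) (ZMod D)) (h m : ℕ),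
        m = 2048 * h ∧ n ≤ 12288 * h ∧ 1 ≤ h ∧
        HX * HZᵀ = 0 ∧ HX.rank + HZ.rank + 2 * m ^ 2 ≤ 2 * n ^ 2 ∧
        (∀ i, ((Finset.univ.filter fun j => HX i j ≠ 0).card) ≤ 2 * n) ∧
        (∀ i, ((Finset.univ.filter fun j => HZ i j ≠ 0).card) ≤ 2 * n) ∧
        (∀ v : Fin (2 * n ^ 2) → ZMod D, HX.mulVec v = 0 →
          v ∉ Submodule.span (ZMod D) (Set.range fun i => HZ i) → h ^ 2 ≤ hamWt v) ∧
        (∀ v : Fin (2 * n ^ 2) → ZMod D, HZ.mulVec v = 0 →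
          v ∉ Submodule.span (ZMod D) (Set.range fun i => HX i) → h ^ 2 ≤ hamWt v) := by
  obtain ⟨h, hh⟩ : ∃ h, h = n / 6144 := ⟨_, rfl⟩
  obtain ⟨m, hm⟩ : ∃ m, m = 2048 * h := ⟨_, rfl⟩
  have hh1 : 1 ≤ h := by omega
  have hn2 : n ≤ 12288 * h := by omega
  have h3m : 3 * m ≤ n := by omega
  have hD : 3 ≤ Fintype.card (ZMod D) := by
    rw [ZMod.card]
    have := (Fact.out : D.Prime).two_le
    obtain ⟨k, hk⟩ := hDodd
    omega
  let κ := Fin m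
  let ι := κ ⊕ ((κ ⊕ κ) ⊕ κ)
  have hκ : Fintype.card κ = m := Fintype.card_fin m
  have hι : Fintype.card ι = 4 * m := by
    simp only [ι, Fintype.card_sum, hκ]; ring
  haveI : Nonempty κ := ⟨⟨0, by omega⟩⟩
  obtain ⟨H, H', G, G', hU, hUG, hHG, hHG', ⟨R1, hR1⟩, ⟨R2, hR2⟩, ⟨R3, hR3⟩, ⟨R4, hR4⟩⟩ :=
    exists_good (F := ZMod D) (κ := κ) hh1 hD (hκ.trans hm)
  have h9 : 18 * m ^ 2 ≤ 2 * n ^ 2 := by nlinarith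
  obtain ⟨p, hp⟩ : ∃ p, 2 * n ^ 2 = 18 * m ^ 2 + p := ⟨_, (Nat.add_sub_of_le h9).symm⟩
  let π := Fin p
  have hQ : Fintype.card (Qd κ ι π) = 2 * n ^ 2 := by
    simp only [Fintype.card_sum, Fintype.card_prod, hκ, π, Fintype.card_fin, ι]
    rw [hp]; ring
  let eQ : Fin (2 * n ^ 2) ≃ Qd κ ι π := (Fintype.equivFinOfCardEq hQ).symm
  let eR : Fin (Fintype.card (Rw κ ι π)) ≃ Rw κ ι π := (Fintype.equivFin _).symm
  let K1 : Matrix (Rw κ ι π) (Qd κ ι π) (ZMod D) := K H H' G G' 1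
  let K2 : Matrix (Rw κ ι π) (Qd κ ι π) (ZMod D) := K G G' (-H) (-H') 0
  have hwt : ∀ (v : Fin (2 * n ^ 2) → ZMod D) (e : Fin (2 * n ^ 2) ≃ Qd κ ι π),
      {c | (v ∘ e.symm) c ≠ 0}.ncard = hamWt v := by
    intro v e
    have := card_filter_equiv e.symm (fun c => v c ≠ 0)
    rw [hamWt, ← this, ← Set.ncard_coe_finset]
    congr 1; ext; simp
  have hrow : ∀ (M : Matrix (Rw κ ι π) (Qd κ ι π) (ZMod D)) (e : Fin (2 * n ^ 2) ≃ Qd κ ι π),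
      (∀ r, (Finset.univ.filter fun c => M r c ≠ 0).card ≤ Fintype.card ι + Fintype.card κ) →
      ∀ i, ((Finset.univ.filter fun j => (M.submatrix eR e) i j ≠ 0).card) ≤ 2 * n := by
    intro M e hM i
    have h1 := card_filter_equiv e (fun c => M (eR i) c ≠ 0)
    have h2 := hM (eR i)
    rw [← h1] at h2
    refine le_trans h2 ?_
    rw [hι, hκ]; omega
  refine ⟨_, K1.submatrix eR eQ, K2.submatrix eR (eQ.trans (sw κ ι π)), h, m, hm, hn2, hh1,
    ?_, ?_, ?_, ?_, ?_, ?_⟩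
  · have h0 := K_orth (π := π) H H' G G' 1 hHG hHG'
    have h1 : (K2.submatrix eR (eQ.trans (sw κ ι π)))ᵀ =
        ((K2.submatrix id (sw κ ι π))ᵀ).submatrix eQ eR := rfl
    rw [h1, Matrix.submatrix_mul_equiv, h0]
    rfl
  · rw [Matrix.rank_submatrix, Matrix.rank_submatrix]
    have h1 := K_rank_one (π := π) H H' G G' 1
    have h2 := K_rank_zero (π := π) G G' (-H) (-H')
    rw [hι, hκ] at h1 h2
    have h3 : Fintype.card π = p := Fintype.card_fin p
    rw [h3] at h1
    have h4 : 2 * (4 * m * m) = 8 * m ^ 2 := by ring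
    change K1.rank ≤ _ at h1
    change K2.rank ≤ _ at h2
    omega
  · exact hrow _ _ (K_weight _ _ _ _ _)
  · exact hrow _ _ (K_weight _ _ _ _ _)
  · intro v hv hns
    by_contra hlt
    push Not at hlt
    apply hns
    obtain ⟨P, Q, z, hz, hvv⟩ := K_ker H H' G G' 1 hh1 hU hHG hHG' hR3 hR4 _
      (reindex_mulVec K1 eR eQ v hv) (by rw [hwt]; exact hlt.le)
    have hz0 : z = fun k => 0 * (0 : π → ZMod D) k := by
      funext k; simpa using hz k
    have hv2 : v = (pack (Q * G' + Gᵀ * P) (-H * Q) (P * (-H')ᵀ) (fun k => 0 * (0 : π → ZMod D) k)) ∘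
        (eQ.trans (sw κ ι π)) := by
      have : v = (v ∘ eQ.symm) ∘ eQ := by funext c; simp
      rw [this, hvv, Equiv.coe_trans, ← Function.comp_assoc, pack_sw, hz0]
      congr 1
      rw [add_comm]; simp
    rw [hv2, ← K_vecMul]
    exact mem_span_reindex K2 eR _ _
  · intro v hv hns
    by_contra hlt
    push Not at hlt
    apply hns
    have hGH : G * (-H)ᵀ = 0 := by
      have := congrArg Matrix.transpose hHG
      simpa using this
    have hGH' : G' * (-H')ᵀ = 0 := by
      have := congrArg Matrix.transpose hHG'
      simpa using this
    obtain ⟨P, Q, z, hz, hvv⟩ := K_ker G G' (-H) (-H') 0 hh1 hUG hGH hGH'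
      (R := -R1) (R' := -R2) (by simpa using hR1) (by simpa using hR2) _
      (reindex_mulVec K2 eR (eQ.trans (sw κ ι π)) v hv) (by rw [hwt]; exact hlt.le)
    have hv2 : v = (pack ((-Q) * H' + Hᵀ * (-P)) (G * (-Q)) ((-P) * G'ᵀ) (fun k => 1 * z k)) ∘ eQ := by
      have : v = (v ∘ (eQ.trans (sw κ ι π)).symm) ∘ (eQ.trans (sw κ ι π)) := by funext c; simp
      rw [this, hvv, Equiv.coe_trans, ← Function.comp_assoc, pack_sw]
      congr 1
      rw [add_comm]; simp
    rw [hv2, ← K_vecMul]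
    exact mem_span_reindex K1 eR _ _

end QHP

theorem good_qudit_homological_product_codes
    {D : ℕ} [Fact D.Prime] (hDodd : Odd D) :
    ∃ ρ c : ℝ, 0 < ρ ∧ 0 < c ∧ ∃ N₀ : ℕ, ∀ n : ℕ, N₀ ≤ n →
      ∃ (s : ℕ) (HX HZ : Matrix (Fin s) (Fin (2 * n ^ 2)) (ZMod D)),
        -- the X- and Z-stabilizers commute
        HX * HZᵀ = 0 ∧
        -- number of logical qudits is at least 2ρ²n²
        2 * ρ ^ 2 * (n : ℝ) ^ 2 ≤ 2 * (n : ℝ) ^ 2 - (HX.rank : ℝ) - (HZ.rank : ℝ) ∧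
        -- all stabilizer generator weights are at most 2n
        (∀ i, ((Finset.univ.filter fun j => HX i j ≠ 0).card) ≤ 2 * n) ∧
        (∀ i, ((Finset.univ.filter fun j => HZ i j ≠ 0).card) ≤ 2 * n) ∧
        -- distance at least cn²: every Z-type logical has weight ≥ cn²
        (∀ v : Fin (2 * n ^ 2) → ZMod D, HX.mulVec v = 0 →
          v ∉ Submodule.span (ZMod D) (Set.range fun i => HZ i) →
          c * (n : ℝ) ^ 2 ≤ (hamWt v : ℝ)) ∧
        -- and every X-type logical has weight ≥ cn²
        (∀ v : Fin (2 * n ^ 2) → ZMod D, HZ.mulVec v = 0 →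
          v ∉ Submodule.span (ZMod D) (Set.range fun i => HX i) →
          c * (n : ℝ) ^ 2 ≤ (hamWt v : ℝ)) := by
  refine ⟨1 / 6, 1 / 12288 ^ 2, by norm_num, by norm_num, 6144, fun n hn => ?_⟩
  obtain ⟨s, HX, HZ, h, m, hm, hnh, hh1, h0, hrk, hw1, hw2, hd1, hd2⟩ := QHP.main hDodd n hn
  have hc : (1 / 12288 ^ 2 : ℝ) * (n : ℝ) ^ 2 ≤ (h : ℝ) ^ 2 := by
    have h1 : (n : ℝ) ≤ 12288 * h := by exact_mod_cast hnh
    have h2 : (n : ℝ) ^ 2 ≤ (12288 * h) ^ 2 := by gcongr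
    rw [mul_pow] at h2
    rw [one_div, inv_mul_le_iff₀ (by positivity)]
    exact h2
  refine ⟨s, HX, HZ, h0, ?_, hw1, hw2, fun v hv hs => hc.trans (by exact_mod_cast hd1 v hv hs),
    fun v hv hs => hc.trans (by exact_mod_cast hd2 v hv hs)⟩
  have h1 : (n : ℝ) ≤ 6 * m := by
    have : n ≤ 6 * m := by omega
    exact_mod_cast this
  have h2 : (n : ℝ) ^ 2 ≤ (6 * m) ^ 2 := by gcongr
  have h3 : (HX.rank : ℝ) + HZ.rank + 2 * (m : ℝ) ^ 2 ≤ 2 * (n : ℝ) ^ 2 := by exact_mod_cast hrk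
  nlinarith
end
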